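/- Let ε ∈ (0,1) and let ℓ be an integer satisfying ⌈(log(ℓ)+1)²⌉ < ⌈ℓ^ε⌉ ≤ ℓ − 2⌈log(ℓ)⌉. Let F be a finite field of odd order, and let H be a subgroup of GL_{2ℓ}(F) with Sp_{2ℓ}(F) ≤ H ≤ GSp_{2ℓ}(F). Then the proportion of elements h ∈ H such that h has even order and h^{|h|/2} is an involution whose (−1)-eigenspace has dimension at most 2⌈ℓ^ε⌉ is greater than ε/768. -/

import Mathlib

open scoped MatrixGroups Matrix

/-- The dimension of the `(-1)`-eigenspace of a square matrix `M`, i.e. the dimension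
of the kernel of `M + I`. -/
noncomputable def negOneEigDim {m : Type*} [Fintype m] [DecidableEq m]
    (F : Type*) [Field F] (M : Matrix m m F) : ℕ :=
  Module.finrank F (LinearMap.ker (Matrix.toLin' (M + 1)))

set_option linter.unusedSectionVars false

namespace S16

lemma half_dvd {s n N : ℕ} (h : n ∣ N) (h1 : ¬ 2 ^ s ∣ n) (h2 : 2 ^ s ∣ N) : n ∣ N / 2 := by
  obtain ⟨c, rfl⟩ := h
  rcases Nat.even_or_odd c with hc | hc
  · obtain ⟨d, rfl⟩ := hc
    refine ⟨d, ?_⟩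
    rw [← two_mul, Nat.mul_left_comm]; simp
  · exfalso; apply h1
    have : Nat.Coprime (2 ^ s) c := Nat.Coprime.pow_left _ (Nat.coprime_two_left.2 hc)
    exact this.dvd_of_dvd_mul_right h2

/-- Arithmetic hypotheses on the threshold exponent `s`. -/
structure Thr (q a s : ℕ) : Prop where
  odd : Odd q
  gt : 1 < q
  ha : 2 ≤ a
  nd : ∀ i, Even i → ¬ 2 ^ s ∣ (q ^ i + 1) * (q - 1)
  up : ∀ j, 2 ^ s ∣ q ^ j - 1 → 2 ^ a ∣ j
  lo : ∀ j, 2 ^ a ∣ j → 2 ^ s ∣ q ^ j - 1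

lemma Thr.three_le {q a s : ℕ} (h : Thr q a s) : 3 ≤ q := by
  obtain ⟨k, hk⟩ := h.odd
  have := h.gt
  omega

lemma Thr.nd' {q a s : ℕ} (h : Thr q a s) : ¬ 2 ^ s ∣ q - 1 := fun h' =>
  h.nd 0 (by simp) (h'.mul_left _)

lemma exists_thr (q a : ℕ) (hq : Odd q) (hq1 : 1 < q) (ha : 2 ≤ a) : ∃ s, Thr q a s := by
  have : Fact (Nat.Prime 2) := ⟨Nat.prime_two⟩
  set c1 := padicValNat 2 (q - 1)
  set c2 := padicValNat 2 (q + 1)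
  have hc1 : 1 ≤ c1 := by
    apply one_le_padicValNat_of_dvd (by omega)
    obtain ⟨k, hk⟩ := hq; omega
  have hc2 : 1 ≤ c2 := by
    apply one_le_padicValNat_of_dvd (by omega)
    obtain ⟨k, hk⟩ := hq; omega
  have hlte : ∀ j, j ≠ 0 → Even j → padicValNat 2 (q ^ j - 1) + 1 = c2 + c1 + padicValNat 2 j := by
    intro j hj hj2
    have := padicValNat.pow_two_sub_pow (x := q) (y := 1) hq1 (by obtain ⟨k, hk⟩ := hq; omega)
      (by obtain ⟨k, hk⟩ := hq; omega) hj hj2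
    simpa using this
  have hne : ∀ j, j ≠ 0 → q ^ j - 1 ≠ 0 := by
    intro j hj
    have := Nat.one_lt_pow hj hq1
    omega
  refine ⟨c1 + c2 + a - 1, hq, hq1, ha, ?_, ?_, ?_⟩
  · intro i hi hd
    have h4 : (q ^ i + 1) % 4 = 2 := by
      obtain ⟨t, rfl⟩ := hi
      obtain ⟨k, rfl⟩ := hq
      have : (2 * k + 1) ^ (t + t) = 4 * (k * (k + 1)) * 0 + ((2*k+1)^2)^t := by
        rw [← two_mul, pow_mul]; ring
      rw [this]
      have h1 : ((2 * k + 1) ^ 2) % 4 = 1 := by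
        have : (2 * k + 1) ^ 2 = 4 * (k * k + k) + 1 := by ring
        omega
      have h2 : (((2 * k + 1) ^ 2) ^ t) % 4 = 1 := by
        rw [Nat.pow_mod, h1]; simp
      omega
    obtain ⟨r, hr⟩ : ∃ r, q ^ i + 1 = 2 * r ∧ Odd r := by
      refine ⟨(q ^ i + 1) / 2, by omega, ?_⟩
      rw [Nat.odd_iff]; omega
    have hd' : 2 ^ (c1 + 2) ∣ (q ^ i + 1) * (q - 1) := (pow_dvd_pow 2 (by omega)).trans hd
    rw [hr.1, mul_comm 2 r, mul_assoc] at hd'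
    have hcop : Nat.Coprime (2 ^ (c1 + 2)) r := Nat.Coprime.pow_left _ (Nat.coprime_two_left.2 hr.2)
    have h3 := hcop.dvd_of_dvd_mul_left hd'
    rw [pow_succ', Nat.mul_dvd_mul_iff_left (by norm_num)] at h3
    rw [padicValNat_dvd_iff_le (by omega)] at h3
    change c1 + 1 ≤ c1 at h3
    omega
  · intro j hj
    rcases eq_or_ne j 0 with rfl | hj0
    · simp
    rcases Nat.even_or_odd j with he | ho
    · rw [padicValNat_dvd_iff_le (hne j hj0)] at hj
      have := hlte j hj0 he
      rw [padicValNat_dvd_iff_le hj0]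
      omega
    · exfalso
      have h1 : q ^ j - 1 = (q - 1) * (∑ i ∈ Finset.range j, q ^ i) := by
        have := Nat.geomSum_eq (m := q) (by omega) j
        rw [this, Nat.mul_div_cancel']
        exact Nat.sub_one_dvd_pow_sub_one q j
      have h2 : Odd (∑ i ∈ Finset.range j, q ^ i) := by
        rw [Finset.odd_sum_iff_odd_card_odd]
        simpa [hq.pow] using ho
      rw [h1] at hj
      have hcop : Nat.Coprime (2 ^ (c1 + c2 + a - 1)) (∑ i ∈ Finset.range j, q ^ i) :=
        Nat.Coprime.pow_left _ (Nat.coprime_two_left.2 h2)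
      have h3 := hcop.dvd_of_dvd_mul_right hj
      rw [padicValNat_dvd_iff_le (by omega)] at h3
      change _ ≤ c1 at h3
      omega
  · intro j hj
    rcases eq_or_ne j 0 with rfl | hj0
    · simp
    have he : Even j := by
      rw [even_iff_two_dvd]
      exact (dvd_pow_self 2 (by omega)).trans hj
    rw [padicValNat_dvd_iff_le (hne j hj0)]
    rw [padicValNat_dvd_iff_le hj0] at hj
    have := hlte j hj0 he
    omega

section field
variable {F K : Type*} [Field F] [Finite F] [Field K] [Finite K] [Algebra F K]

/-- `α` generates `K` over `F` and has order divisible by `2 ^ s`. -/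
def bad (F : Type*) {K : Type*} [Field F] [Field K] [Algebra F K] (s : ℕ) (α : Kˣ) : Prop :=
  Algebra.adjoin F {(α : K)} = ⊤ ∧ 2 ^ s ∣ orderOf α

lemma bad.exists_poly {s : ℕ} {α : Kˣ} (h : bad F s α) (x : K) :
    ∃ p : Polynomial F, Polynomial.aeval (α : K) p = x := by
  have : x ∈ Algebra.adjoin F {(α : K)} := by rw [h.1]; trivial
  rw [Algebra.adjoin_singleton_eq_range_aeval] at this
  exact this

lemma bad.conj {s : ℕ} {α : Kˣ} (h : bad F s α) (σ : K ≃ₐ[F] K) :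
    bad F s (Units.map (σ : K →* K) α) := by
  constructor
  · have := congrArg (Subalgebra.map (σ : K →ₐ[F] K)) h.1
    rw [AlgHom.map_adjoin] at this
    have h2 : (σ : K →ₐ[F] K).range = ⊤ := (AlgHom.range_eq_top _).2 σ.surjective
    simpa [h2] using this
  · rw [orderOf_injective (Units.map (σ : K →* K)) (Units.map_injective σ.injective)]
    exact h.2

lemma bad.card_dvd {a s : ℕ} (hs : Thr (Nat.card F) a s) {α : Kˣ} (h : bad F s α) :
    2 ^ a ∣ Module.finrank F K := by
  apply hs.up
  have := h.2.trans (orderOf_dvd_natCard α)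
  rwa [Nat.card_units, Module.natCard_eq_pow_finrank (K := F) (V := K)] at this

lemma bad.not_conj {a s : ℕ} (hs : Thr (Nat.card F) a s) {α : Kˣ} (h : bad F s α)
    (c : Fˣ) (σ : K ≃ₐ[F] K) (hσ : σ (α : K) = algebraMap F K c * (α : K)⁻¹) : False := by
  have := Fintype.ofFinite F
  obtain ⟨i, hi⟩ := (FiniteField.bijective_frobeniusAlgEquivOfAlgebraic_pow F K).2 σ
  have hfr : ∀ (n : ℕ) (x : K), (FiniteField.frobeniusAlgEquivOfAlgebraic F K ^ n) x =
      x ^ (Nat.card F ^ n) := by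
    intro n x
    rw [AlgEquiv.coe_pow, FiniteField.coe_frobeniusAlgEquivOfAlgebraic_iterate,
      Nat.card_eq_fintype_card]
  have hα0 : (α : K) ≠ 0 := α.ne_zero
  have h2 : σ (σ (α : K)) = α := by
    rw [hσ, map_mul, map_inv₀, hσ, AlgEquiv.commutes]
    have : algebraMap F K c ≠ 0 := by simp
    field_simp
  have h3 : σ * σ = 1 := by
    ext x
    obtain ⟨p, rfl⟩ := h.exists_poly x
    simp only [AlgEquiv.mul_apply, AlgEquiv.one_apply]
    have e : ∀ y : K, σ (Polynomial.aeval y p) = Polynomial.aeval (σ y) p := fun y =>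
      (Polynomial.aeval_algHom_apply (σ : K →ₐ[F] K) y p).symm
    rw [e, e, h2]
  have hi2 : Module.finrank F K ∣ 2 * i.1 := by
    have e := FiniteField.orderOf_frobeniusAlgEquivOfAlgebraic F K
    simp only at hi
    generalize i.1 = n at *
    rw [← e, orderOf_dvd_iff_pow_eq_one, two_mul, pow_add]
    rw [hi, h3]
  have h4 : 4 ∣ Module.finrank F K :=
    (pow_dvd_pow 2 hs.ha).trans (h.card_dvd hs)
  have hie : Even i.1 := by
    obtain ⟨t, ht⟩ := h4.trans hi2
    exact ⟨t, by omega⟩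
  apply hs.nd i.1 hie
  apply h.2.trans
  rw [orderOf_dvd_iff_pow_eq_one, pow_mul]
  ext
  push_cast
  have h5 : (α : K) ^ (Nat.card F ^ i.1 + 1) = algebraMap F K c := by
    simp only at hi
    rw [pow_succ, ← hfr, hi, hσ]
    field_simp
  rw [h5, ← map_pow, Nat.card_eq_fintype_card, FiniteField.pow_card_sub_one_eq_one _ c.ne_zero,
    map_one]

lemma exists_conj {x y : K} (h : Polynomial.aeval y (minpoly F x) = 0) :
    ∃ σ : K ≃ₐ[F] K, σ x = y :=
  minpoly.exists_algEquiv_of_root' (Algebra.IsAlgebraic.isAlgebraic x) h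

lemma bad.aeval_ne {a s : ℕ} (hs : Thr (Nat.card F) a s) {α : Kˣ} (h : bad F s α)
    (c : Fˣ) : Polynomial.aeval (algebraMap F K c * (α : K)⁻¹) (minpoly F (α : K)) ≠ 0 := by
  intro h0
  obtain ⟨σ, hσ⟩ := exists_conj h0
  exact h.not_conj hs c σ hσ

lemma geom_bd (q n : ℕ) (hq : 3 ≤ q) : 2 * ∑ d ∈ Finset.range (n + 1), q ^ d ≤ 3 * q ^ n := by
  induction n with
  | zero => simp
  | succ n ih =>
    rw [Finset.sum_range_succ, mul_add]
    have : 3 * q ^ n ≤ q ^ (n + 1) := by rw [pow_succ']; gcongr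
    omega

lemma card_bad {a s : ℕ} (hs : Thr (Nat.card F) a s) (hk : 2 ^ a ∣ Module.finrank F K) :
    Nat.card K - 1 ≤ 4 * Nat.card {α : Kˣ // bad F s α} := by
  classical
  have := Fintype.ofFinite K
  set q := Nat.card F with hq
  set k := Module.finrank F K with hkdef
  have hkpos : 0 < k := Module.finrank_pos
  have hcard : Nat.card K = q ^ k := Module.natCard_eq_pow_finrank
  have hN : Fintype.card Kˣ = q ^ k - 1 := by
    rw [Fintype.card_eq_nat_card, Nat.card_units, hcard]
  have h4 : 4 ∣ k := (pow_dvd_pow 2 hs.ha).trans hk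
  obtain ⟨t, ht⟩ := h4
  have ht0 : 0 < t := by omega
  have h3 := hs.three_le
  set Q := q ^ (2 * t) with hQ
  have hQ9 : 9 ≤ Q := by
    calc 9 = 3 ^ 2 := by norm_num
      _ ≤ q ^ 2 := Nat.pow_le_pow_left h3 2
      _ ≤ q ^ (2 * t) := Nat.pow_le_pow_right (by omega) (by omega)
  have hQQ : q ^ k = Q * Q := by rw [hQ, ← pow_add]; congr 1; omega
  have hN2 : 2 ^ s ∣ q ^ k - 1 := hs.lo k hk
  have hs0 : s ≠ 0 := by
    rintro rfl
    exact hs.nd' (by simp)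
  have hNe : 2 ∣ q ^ k - 1 := (dvd_pow_self 2 hs0).trans hN2
  have hNpos : 2 ≤ q ^ k - 1 := by
    have : 81 ≤ Q * Q := Nat.mul_le_mul hQ9 hQ9
    omega
  let Bd : Finset Kˣ := Finset.univ.filter (fun α => bad F s α)
  let A0 : Finset Kˣ := Finset.univ.filter (fun α => α ^ ((q ^ k - 1) / 2) = 1)
  let A1 : ℕ → Finset Kˣ := fun d => Finset.univ.filter (fun α => α ^ (q ^ d - 1) = 1)
  have hcov : (Finset.univ : Finset Kˣ) ⊆ Bd ∪ (A0 ∪ (Finset.Icc 1 (2 * t)).biUnion A1) := by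
    intro α _
    by_cases h1 : 2 ^ s ∣ orderOf α
    · by_cases h2 : Algebra.adjoin F {(α : K)} = ⊤
      · apply Finset.mem_union_left
        simp only [Bd, Finset.mem_filter_univ]
        exact ⟨h2, h1⟩
      · apply Finset.mem_union_right
        apply Finset.mem_union_right
        let E := IntermediateField.adjoin F {(α : K)}
        have hE : E ≠ ⊤ := by
          intro h
          apply h2
          rw [← IntermediateField.adjoin_simple_toSubalgebra_of_isAlgebraic
            (Algebra.IsAlgebraic.isAlgebraic (α : K))]
          change E.toSubalgebra = ⊤
          rw [h]; rfl
        have hmul : Module.finrank F E * Module.finrank E K = k :=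
          Module.finrank_mul_finrank F E K
        have h1' : Module.finrank E K ≠ 1 := by
          intro h
          exact hE (IntermediateField.finrank_eq_one_iff_eq_top.1 h)
        have hEK : 0 < Module.finrank E K := Module.finrank_pos
        have hFE : 0 < Module.finrank F E := Module.finrank_pos
        have hle : Module.finrank F E ≤ 2 * t := by
          have : Module.finrank F E * 2 ≤ Module.finrank F E * Module.finrank E K :=
            Nat.mul_le_mul_left _ (by omega)
          omega
        refine Finset.mem_biUnion.2 ⟨Module.finrank F E, Finset.mem_Icc.2 ⟨hFE, hle⟩, ?_⟩
        simp only [A1, Finset.mem_filter_univ]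
        have hcE : Nat.card E = q ^ Module.finrank F E := Module.natCard_eq_pow_finrank
        have hmem : (α : K) ∈ E := IntermediateField.mem_adjoin_simple_self F (α : K)
        have hfin : Fintype E := Fintype.ofFinite E
        have := FiniteField.pow_card_sub_one_eq_one (⟨(α : K), hmem⟩ : E)
          (fun h => α.ne_zero (congrArg Subtype.val h))
        rw [Fintype.card_eq_nat_card, hcE] at this
        ext
        simpa using congrArg Subtype.val this
    · apply Finset.mem_union_right
      apply Finset.mem_union_left
      simp only [A0, Finset.mem_filter_univ]
      rw [← orderOf_dvd_iff_pow_eq_one]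
      apply half_dvd _ h1 hN2
      rw [← hN]
      exact orderOf_dvd_card
  have hb0 : A0.card ≤ (q ^ k - 1) / 2 := IsCyclic.card_pow_eq_one_le (by omega)
  have hb1 : ∀ d ∈ Finset.Icc 1 (2 * t), (A1 d).card ≤ q ^ d := by
    intro d hd
    rw [Finset.mem_Icc] at hd
    have : 1 < q ^ d := Nat.one_lt_pow (by omega) hs.gt
    refine (IsCyclic.card_pow_eq_one_le (by omega)).trans (Nat.sub_le _ _)
  have hb2 : ((Finset.Icc 1 (2 * t)).biUnion A1).card ≤ ∑ d ∈ Finset.range (2 * t + 1), q ^ d := by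
    refine Finset.card_biUnion_le.trans ((Finset.sum_le_sum hb1).trans ?_)
    apply Finset.sum_le_sum_of_subset
    intro d hd
    rw [Finset.mem_Icc] at hd
    exact Finset.mem_range.2 (by omega)
  have hg := geom_bd q (2 * t) h3
  have hBd : Nat.card {α : Kˣ // bad F s α} = Bd.card := by
    rw [Nat.card_eq_fintype_card, Fintype.card_subtype]
  have htot := Finset.card_le_card hcov
  rw [Finset.card_univ, hN] at htot
  have hu1 := Finset.card_union_le Bd (A0 ∪ (Finset.Icc 1 (2 * t)).biUnion A1)
  have hu2 := Finset.card_union_le A0 ((Finset.Icc 1 (2 * t)).biUnion A1)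
  rw [hBd, hcard]
  have h6 : 6 * Q + 1 ≤ q ^ k := by rw [hQQ]; nlinarith
  change _ ≤ 3 * Q at hg
  omega

end field
end S16

namespace S16

section sympl
variable {F W : Type*} [Field F] [AddCommGroup W] [Module F W]

/-- nondegenerate alternating form -/
structure Sympl (B : W →ₗ[F] W →ₗ[F] F) : Prop where
  alt : ∀ x, B x x = 0
  nd : ∀ x, (∀ y, B x y = 0) → x = 0

lemma Sympl.skew {B : W →ₗ[F] W →ₗ[F] F} (hB : Sympl B) (x y : W) : B x y = - B y x := by
  have := hB.alt (x + y)
  simp only [map_add, LinearMap.add_apply, hB.alt] at this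
  linear_combination this

lemma Sympl.symm0 {B : W →ₗ[F] W →ₗ[F] F} (hB : Sympl B) {x y : W} (h : B x y = 0) :
    B y x = 0 := by
  rw [hB.skew, h, neg_zero]

/-- Group of similitudes with multipliers in `L`. -/
def simil (B : W →ₗ[F] W →ₗ[F] F) (L : Subgroup Fˣ) : Subgroup (W ≃ₗ[F] W) where
  carrier := {g | ∃ c ∈ L, ∀ u v, B (g u) (g v) = (c : F) * B u v}
  mul_mem' := by
    rintro g h ⟨c, hc, hg⟩ ⟨d, hd, hh⟩
    refine ⟨c * d, L.mul_mem hc hd, fun u v => ?_⟩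
    simp only [LinearEquiv.mul_apply, hg, hh, Units.val_mul, mul_assoc]
  one_mem' := ⟨1, L.one_mem, fun u v => by simp⟩
  inv_mem' := by
    rintro g ⟨c, hc, hg⟩
    refine ⟨c⁻¹, L.inv_mem hc, fun u v => ?_⟩
    have := hg (g⁻¹ u) (g⁻¹ v)
    have e : ∀ u, g (g⁻¹ u) = u := fun u => LinearEquiv.apply_symm_apply g u
    rw [e, e] at this
    rw [this]
    simp

lemma mem_simil {B : W →ₗ[F] W →ₗ[F] F} {L : Subgroup Fˣ} {g : W ≃ₗ[F] W} :
    g ∈ simil B L ↔ ∃ c ∈ L, ∀ u v, B (g u) (g v) = (c : F) * B u v := Iff.rfl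

lemma simil_mono {B : W →ₗ[F] W →ₗ[F] F} {L : Subgroup Fˣ} {g : W ≃ₗ[F] W}
    (h : g ∈ simil B ⊥) : g ∈ simil B L := by
  obtain ⟨c, hc, hg⟩ := h
  rw [Subgroup.mem_bot] at hc
  subst hc
  exact ⟨1, L.one_mem, hg⟩

/-- transvection -/
def transv (B : W →ₗ[F] W →ₗ[F] F) (hB : Sympl B) (x : W) (c : F) : W ≃ₗ[F] W :=
  LinearEquiv.ofLinearMap (LinearMap.id + (c • B x).smulRight x)
    (LinearMap.id + ((-c) • B x).smulRight x)
    (by ext y; simp [hB.alt]) (by ext y; simp [hB.alt])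

lemma transv_apply (B : W →ₗ[F] W →ₗ[F] F) (hB : Sympl B) (x : W) (c : F) (y : W) :
    transv B hB x c y = y + (c * B x y) • x := by
  simp [transv]

lemma transv_mem (B : W →ₗ[F] W →ₗ[F] F) (hB : Sympl B) (x : W) (c : F) :
    transv B hB x c ∈ simil B ⊥ := by
  refine ⟨1, Subgroup.one_mem _, fun u v => ?_⟩
  simp only [transv_apply, map_add, map_smul, LinearMap.add_apply, LinearMap.smul_apply, hB.alt,
    smul_eq_mul, Units.val_one]
  rw [hB.skew u x]
  ring

lemma step1 {B : W →ₗ[F] W →ₗ[F] F} (hB : Sympl B) {n : ℕ} (us : Fin n → W) (u w : W)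
    (h1 : ∀ i, B (us i) u = 0) (h2 : ∀ i, B (us i) w = 0) (h : B u w ≠ 0) :
    ∃ g ∈ simil B ⊥, (∀ i, g (us i) = us i) ∧ g u = w := by
  have h' : B w u ≠ 0 := fun h0 => h (hB.symm0 h0)
  refine ⟨transv B hB (w - u) (B w u)⁻¹, transv_mem _ _ _ _, fun i => ?_, ?_⟩
  · rw [transv_apply]
    simp [hB.symm0 (h1 i), hB.symm0 (h2 i)]
  · rw [transv_apply]
    simp [hB.alt, h']

lemma step2 {B : W →ₗ[F] W →ₗ[F] F} (hB : Sympl B) {n : ℕ} (us : Fin n → W) (u w : W)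
    (h1 : ∀ i, B (us i) u = 0) (h2 : ∀ i, B (us i) w = 0)
    (h3 : ∃ z, (∀ i, B (us i) z = 0) ∧ B u z ≠ 0) (h4 : ∃ z, (∀ i, B (us i) z = 0) ∧ B w z ≠ 0) :
    ∃ g ∈ simil B ⊥, (∀ i, g (us i) = us i) ∧ g u = w := by
  have hz : ∃ z, (∀ i, B (us i) z = 0) ∧ B u z ≠ 0 ∧ B w z ≠ 0 := by
    obtain ⟨z1, a1, b1⟩ := h3
    obtain ⟨z2, a2, b2⟩ := h4
    by_cases c1 : B w z1 = 0
    · by_cases c2 : B u z2 = 0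
      · exact ⟨z1 + z2, fun i => by simp [a1, a2], by simp [c2, b1], by simp [c1, b2]⟩
      · exact ⟨z2, a2, c2, b2⟩
    · exact ⟨z1, a1, b1, c1⟩
  obtain ⟨z, hz, hu, hw⟩ := hz
  obtain ⟨g1, m1, f1, e1⟩ := step1 hB us u z h1 hz hu
  obtain ⟨g2, m2, f2, e2⟩ := step1 hB us z w hz h2 (fun h0 => hw (hB.symm0 h0))
  refine ⟨g2 * g1, Subgroup.mul_mem _ m2 m1, fun i => ?_, ?_⟩
  · rw [LinearEquiv.mul_apply, f1, f2]
  · rw [LinearEquiv.mul_apply, e1, e2]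

variable [FiniteDimensional F W]

lemma exists_z {B : W →ₗ[F] W →ₗ[F] F} (hB : Sympl B) {n : ℕ} (us : Fin n → W) (u : W)
    (h : u ∉ Submodule.span F (Set.range us)) : ∃ z, (∀ i, B (us i) z = 0) ∧ B u z ≠ 0 := by
  obtain ⟨f, hf, hf2⟩ := Submodule.exists_le_ker_of_notMem h
  have hinj : Function.Injective B := by
    rw [← LinearMap.ker_eq_bot, LinearMap.ker_eq_bot']
    intro x hx
    exact hB.nd x fun y => by rw [hx]; rfl
  have hsurj : Function.Surjective B := by
    apply (LinearMap.injective_iff_surjective_of_finrank_eq_finrank _).1 hinj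
    exact (Subspace.dual_finrank_eq).symm
  obtain ⟨z, rfl⟩ := hsurj f
  refine ⟨z, fun i => hB.symm0 ?_, fun h0 => hf (hB.symm0 h0)⟩
  exact hf2 (Submodule.subset_span ⟨i, rfl⟩)

lemma witt {B : W →ₗ[F] W →ₗ[F] F} (hB : Sympl B) : ∀ {n : ℕ} (u w : Fin n → W),
    LinearIndependent F u → LinearIndependent F w → (∀ i j, B (u i) (u j) = 0) →
    (∀ i j, B (w i) (w j) = 0) → ∃ g ∈ simil B ⊥, ∀ i, g (u i) = w i := by
  intro n
  induction n with
  | zero => exact fun u w _ _ _ _ => ⟨1, Subgroup.one_mem _, fun i => i.elim0⟩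
  | succ n ih =>
    intro u w hu hw hu2 hw2
    have hu' := linearIndependent_finSucc'.1 hu
    have hw' := linearIndependent_finSucc'.1 hw
    obtain ⟨g, hg, hgu⟩ := ih (Fin.init u) (Fin.init w) hu'.1 hw'.1 (fun i j => hu2 _ _)
      (fun i j => hw2 _ _)
    have hgB : ∀ x y, B (g x) (g y) = B x y := by
      obtain ⟨c, hc, h⟩ := hg
      rw [Subgroup.mem_bot] at hc
      subst hc
      simpa using h
    have hspan : g (u (Fin.last n)) ∉ Submodule.span F (Set.range (Fin.init w)) := by
      intro h
      apply hu'.2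
      have : Set.range (Fin.init w) = Set.image (g : W →ₗ[F] W) (Set.range (Fin.init u)) := by
        rw [← Set.range_comp]
        congr 1
        ext i
        exact (hgu i).symm
      rw [this, Submodule.span_image] at h
      obtain ⟨x, hx, hx2⟩ := h
      have := g.injective hx2
      rwa [← this]
    obtain ⟨g', hg', h1, h2⟩ := step2 hB (Fin.init w) (g (u (Fin.last n))) (w (Fin.last n))
      (fun i => by rw [← hgu, hgB]; exact hu2 _ _) (fun i => hw2 _ _)
      (exists_z hB _ _ hspan) (exists_z hB _ _ hw'.2)
    refine ⟨g' * g, Subgroup.mul_mem _ hg' hg, fun i => ?_⟩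
    rw [LinearEquiv.mul_apply]
    refine Fin.lastCases ?_ (fun i => ?_) i
    · exact h2
    · have := hgu i
      simp only [Fin.init] at this
      rw [this]
      exact h1 i

lemma witt' {B : W →ₗ[F] W →ₗ[F] F} (hB : Sympl B) {U : Type*} [AddCommGroup U] [Module F U]
    [FiniteDimensional F U] (f f' : U →ₗ[F] W) (hf : Function.Injective f)
    (hf' : Function.Injective f') (h : ∀ x y, B (f x) (f y) = 0)
    (h' : ∀ x y, B (f' x) (f' y) = 0) : ∃ g ∈ simil B ⊥, ∀ x, g (f x) = f' x := by
  let b := Module.finBasis F U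
  obtain ⟨g, hg, hgb⟩ := witt hB (f ∘ b) (f' ∘ b)
    (b.linearIndependent.map' f (LinearMap.ker_eq_bot.2 hf))
    (b.linearIndependent.map' f' (LinearMap.ker_eq_bot.2 hf')) (fun i j => h _ _) (fun i j => h' _ _)
  refine ⟨g, hg, fun x => ?_⟩
  have : (g : W →ₗ[F] W) ∘ₗ f = f' := b.ext hgb
  exact LinearMap.congr_fun this x

lemma iso_finrank {B : W →ₗ[F] W →ₗ[F] F} (hB : Sympl B) {U : Type*} [AddCommGroup U] [Module F U]
    [FiniteDimensional F U] (f : U →ₗ[F] W) (hf : Function.Injective f)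
    (h : ∀ x y, B (f x) (f y) = 0) : 2 * Module.finrank F U ≤ Module.finrank F W := by
  -- the map `W → Dual U`, `w ↦ B w ∘ f`, is surjective with kernel containing the range of `f`
  let φ : W →ₗ[F] Module.Dual F U := (LinearMap.lcomp F F f) ∘ₗ B
  have hinj : Function.Injective B := by
    rw [← LinearMap.ker_eq_bot, LinearMap.ker_eq_bot']
    intro x hx
    exact hB.nd x fun y => by rw [hx]; rfl
  have hsurj : Function.Surjective B := by
    apply (LinearMap.injective_iff_surjective_of_finrank_eq_finrank _).1 hinj
    exact (Subspace.dual_finrank_eq).symm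
  have hφ : Function.Surjective φ := by
    have : Function.Surjective (LinearMap.lcomp F F f : (W →ₗ[F] F) →ₗ[F] (U →ₗ[F] F)) :=
      LinearMap.dualMap_surjective_of_injective hf
    exact this.comp hsurj
  have h1 := LinearMap.finrank_range_add_finrank_ker φ
  rw [LinearMap.range_eq_top.2 hφ, finrank_top, Subspace.dual_finrank_eq] at h1
  have h2 : LinearMap.range f ≤ LinearMap.ker φ := by
    rintro _ ⟨x, rfl⟩
    rw [LinearMap.mem_ker]
    ext y
    exact h x y
  have h3 := Submodule.finrank_mono h2
  rw [LinearMap.finrank_range_of_inj hf] at h3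
  omega

end sympl
end S16

namespace S16
open Polynomial

section eqv
variable {F K M : Type*} [Field F] [Finite F] [Field K] [Finite K] [Algebra F K]
  [AddCommGroup M] [Module F M]

lemma eqv_aeval {α : K} {Y : M →ₗ[F] M} {φ : K →ₗ[F] M} (h : ∀ x, φ (α * x) = Y (φ x))
    (p : F[X]) (x : K) : φ (aeval α p * x) = aeval Y p (φ x) := by
  induction p using Polynomial.induction_on' with
  | add p q hp hq => simp only [map_add, add_mul, hp, hq, LinearMap.add_apply]
  | monomial n a =>
    have : ∀ x, φ (α ^ n * x) = (Y ^ n) (φ x) := by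
      induction n with
      | zero => simp
      | succ n ih => intro x; rw [pow_succ, mul_assoc, ih, h, pow_succ, Module.End.mul_apply]
    rw [aeval_monomial, aeval_monomial, mul_assoc, ← Algebra.smul_def, map_smul, this,
      ← Algebra.smul_def, LinearMap.smul_apply]

lemma eqv_zero {s : ℕ} {α : Kˣ} (hα : bad F s α) {Y : M →ₗ[F] M} {φ : K →ₗ[F] M}
    (h : ∀ x, φ (α * x) = Y (φ x)) {x : K} (hx : x ≠ 0) (h0 : φ x = 0) : φ = 0 := by
  ext y
  obtain ⟨p, hp⟩ := hα.exists_poly (y * x⁻¹)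
  have := eqv_aeval h p x
  rw [hp, h0, map_zero, mul_assoc, inv_mul_cancel₀ hx, mul_one] at this
  simpa using this

lemma eqv_inj {s : ℕ} {α : Kˣ} (hα : bad F s α) {Y : M →ₗ[F] M} {φ : K →ₗ[F] M}
    (h : ∀ x, φ (α * x) = Y (φ x)) (h0 : φ ≠ 0) : Function.Injective φ := by
  rw [← LinearMap.ker_eq_bot, LinearMap.ker_eq_bot']
  intro x hx
  by_contra hx0
  exact h0 (eqv_zero hα h hx0 hx)

end eqv

section thm1
variable {F K W : Type*} [Field F] [Finite F] [Field K] [Finite K] [Algebra F K]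
  [AddCommGroup W] [Module F W] [Finite W]

/-- `f` intertwines multiplication by `α` with `g`. -/
def isEq (g : W ≃ₗ[F] W) (α : Kˣ) (f : K →ₗ[F] W) : Prop :=
  Function.Injective f ∧ ∀ x, g (f x) = f (α * x)

lemma isEq.iso {B : W →ₗ[F] W →ₗ[F] F} {L : Subgroup Fˣ} {g : W ≃ₗ[F] W} (hg : g ∈ simil B L)
    {a s : ℕ} (hs : Thr (Nat.card F) a s) {α : Kˣ} (hα : bad F s α) {f : K →ₗ[F] W}
    (hf : isEq g α f) (x y : K) : B (f x) (f y) = 0 := by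
  obtain ⟨c, -, hc⟩ := hg
  have hα0 : (α : K) ≠ 0 := α.ne_zero
  have key1 : ∀ x y, B (f (α * x)) (f y) = B (f x) (f ((algebraMap F K c * (α : K)⁻¹) * y)) := by
    intro x y
    have h1 : f y = g (f ((α : K)⁻¹ * y)) := by
      rw [hf.2, ← mul_assoc, mul_inv_cancel₀ hα0, one_mul]
    rw [h1, ← hf.2, hc, mul_assoc, ← Algebra.smul_def, map_smul, map_smul, smul_eq_mul]
  have key2 : ∀ (n : ℕ) x y, B (f ((α : K) ^ n * x)) (f y) =
      B (f x) (f ((algebraMap F K c * (α : K)⁻¹) ^ n * y)) := by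
    intro n
    induction n with
    | zero => simp
    | succ n ih =>
      intro x y
      rw [pow_succ, mul_assoc, ih, key1, ← mul_assoc, pow_succ']
  have key3 : ∀ (p : F[X]) x y, B (f (aeval (α : K) p * x)) (f y) =
      B (f x) (f (aeval (algebraMap F K c * (α : K)⁻¹) p * y)) := by
    intro p
    induction p using Polynomial.induction_on' with
    | add p q hp hq => intro x y; simp only [map_add, add_mul, LinearMap.add_apply, hp, hq]
    | monomial n r =>
      intro x y
      rw [aeval_monomial, aeval_monomial, mul_assoc, mul_assoc, ← Algebra.smul_def,
        ← Algebra.smul_def]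
      simp only [map_smul, LinearMap.smul_apply, key2]
  have h0 := hα.aeval_ne hs c
  have := key3 (minpoly F (α : K)) x ((aeval (algebraMap F K c * (α : K)⁻¹) (minpoly F (α : K)))⁻¹ * y)
  rw [minpoly.aeval, zero_mul, ← mul_assoc, mul_inv_cancel₀ h0, one_mul, map_zero, map_zero] at this
  simpa using this.symm

instance finLE {F W : Type*} [Field F] [AddCommGroup W] [Module F W] [Finite W] :
    Finite (W ≃ₗ[F] W) := DFunLike.finite _
instance finLM {F K W : Type*} [Field F] [AddCommGroup K] [Module F K] [Finite K]
    [AddCommGroup W] [Module F W] [Finite W] :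
    Finite (K →ₗ[F] W) := DFunLike.finite _

/-- elements having a bad submodule isomorphic to `K` -/
def badType (K : Type*) [Field K] [Algebra F K] (s : ℕ) (B : W →ₗ[F] W →ₗ[F] F) (L : Subgroup Fˣ)
    (g : simil B L) : Prop :=
  ∃ α : Kˣ, bad F s α ∧ ∃ f : K →ₗ[F] W, isEq g.1 α f

lemma badType_card {B : W →ₗ[F] W →ₗ[F] F} (hB : Sympl B) (L : Subgroup Fˣ)
    {a s : ℕ} (hs : Thr (Nat.card F) a s) :
    Nat.card {g : simil B L // badType K s B L g} * Module.finrank F K ≤ Nat.card (simil B L) := by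
  classical
  let P := {x : simil B L × Kˣ × (K →ₗ[F] W) // bad F s x.2.1 ∧ isEq x.1.1 x.2.1 x.2.2}
  have hWf : Module.Finite F W := Module.Finite.of_finite
  have hP1 : Nat.card P ≤ Nat.card (Kˣ × simil B L) := by
    rcases isEmpty_or_nonempty P with hP | ⟨⟨⟨⟨g0, α0, f0⟩, hb0, he0⟩⟩⟩
    · simp
    let γ : (K →ₗ[F] W) → simil B L := fun f =>
      if h : ∃ g ∈ simil B ⊥, ∀ x, g (f0 x) = f x then ⟨h.choose, simil_mono h.choose_spec.1⟩ else 1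
    have hγ : ∀ x : P, ∀ y, (γ x.1.2.2).1 (f0 y) = x.1.2.2 y := by
      intro x y
      have h : ∃ g ∈ simil B ⊥, ∀ y, g (f0 y) = x.1.2.2 y :=
        witt' hB f0 x.1.2.2 he0.1 x.2.2.1 (he0.iso g0.2 hs hb0)
          (x.2.2.iso x.1.1.2 hs x.2.1)
      simp only [γ, dif_pos h]
      exact h.choose_spec.2 y
    refine Nat.card_le_card_of_injective
      (fun x : P => ((x.1.2.1, x.1.1 * γ x.1.2.2) : Kˣ × simil B L)) ?_
    intro x x' hxx
    simp only [Prod.mk.injEq] at hxx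
    obtain ⟨h1, h2⟩ := hxx
    have h3 : x.1.2.2 = x'.1.2.2 := by
      ext y
      have e : ∀ x : P, ∀ y, (x.1.1 * γ x.1.2.2).1 (f0 y) = x.1.2.2 (x.1.2.1 * y) := by
        intro x y
        rw [Subgroup.coe_mul, LinearEquiv.mul_apply, hγ, x.2.2.2]
      have h4 := e x ((x.1.2.1 : K)⁻¹ * y)
      rw [h2, e x', h1] at h4
      rw [← mul_assoc, mul_inv_cancel₀ (Units.ne_zero _), one_mul] at h4
      exact h4.symm
    have h4 : x.1.1 = x'.1.1 := by
      rw [h3] at h2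
      exact mul_right_cancel h2
    ext1
    exact Prod.ext h4 (Prod.ext h1 h3)
  have hP2 : Nat.card ({g : simil B L // badType K s B L g} × (K ≃ₐ[F] K) × Kˣ) ≤ Nat.card P := by
    choose A hA f hf using fun g : {g : simil B L // badType K s B L g} => g.2
    refine Nat.card_le_card_of_injective (fun x => (⟨(x.1.1, Units.map (x.2.1.symm : K →* K) (A x.1),
      (f x.1) ∘ₗ (LinearMap.mulLeft F (x.2.2 : K)) ∘ₗ x.2.1.toLinearMap),
      (hA x.1).conj x.2.1.symm, ?_, ?_⟩ : P)) ?_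
    · intro u v huv
      have := (hf x.1).1 huv
      simpa using this
    · intro u
      simp only [LinearMap.comp_apply, (hf x.1).2]
      congr 1
      simp
      ring
    · rintro ⟨g, σ, β⟩ ⟨g', σ', β'⟩ h
      have h' := congrArg Subtype.val h
      have h1 : g = g' := Subtype.ext (congrArg Prod.fst h')
      have h2 := congrArg (fun z => z.2.1) h'
      have h3 := congrArg (fun z => z.2.2) h'
      subst h1
      have h4 : σ.symm = σ'.symm := by
        ext x
        obtain ⟨p, rfl⟩ := (hA g).exists_poly x
        have e : ∀ τ : K ≃ₐ[F] K, τ (aeval (A g : K) p) = aeval (τ (A g : K)) p := fun τ =>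
          (Polynomial.aeval_algHom_apply (τ : K →ₐ[F] K) _ p).symm
        rw [e, e]
        congr 2
        exact congrArg Units.val h2
      have h5 : σ = σ' := by
        rw [← AlgEquiv.symm_symm σ, h4, AlgEquiv.symm_symm]
      subst h5
      have h6 := LinearMap.congr_fun h3 1
      simp only [LinearMap.comp_apply] at h6
      have h7 := (hf g).1 h6
      simp at h7
      have h8 : β = β' := Units.ext h7
      rw [h8]
  have h := hP2.trans hP1
  rw [Nat.card_prod, Nat.card_prod, Nat.card_prod, IsGalois.card_aut_eq_finrank, ← mul_assoc,
    mul_comm (Nat.card Kˣ)] at h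
  exact Nat.le_of_mul_le_mul_right h Nat.card_pos

lemma inj_of_irred {G : W →ₗ[F] W} (u : F[X]) (hu : u ≠ 0)
    (h : ∀ f, Irreducible f → f ∣ u → Function.Injective (aeval G f)) :
    Function.Injective (aeval G u) := by
  induction u using WfDvdMonoid.induction_on_irreducible with
  | zero => exact absurd rfl hu
  | unit u hunit =>
    obtain ⟨v, hv⟩ := hunit.exists_left_inv
    have := congrArg (aeval G) hv
    rw [map_mul, map_one] at this
    intro x y hxy
    have e : ∀ x, aeval G v (aeval G u x) = x := fun x => by
      rw [← Module.End.mul_apply, this, Module.End.one_apply]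
    rw [← e x, hxy, e y]
  | mul u i hu0 hi ih =>
    rw [map_mul]
    exact (h i hi (dvd_mul_right _ _)).comp (ih hu0 fun f hf hfd => h f hf (hfd.mul_left _))

lemma nonempty_algEquiv {K' : Type*} [Field K'] [Algebra F K'] [FiniteDimensional F K']
    (h : Module.finrank F K' = Module.finrank F K) : Nonempty (K' ≃ₐ[F] K) := by
  let p := ringChar F
  have : CharP F p := ringChar.charP F
  have : Fact p.Prime := ⟨CharP.char_is_prime F p⟩
  have : NeZero (Module.finrank F K) := ⟨Module.finrank_pos.ne'⟩
  exact ⟨(FiniteField.algEquivExtension F p _ K' h).trans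
    (FiniteField.algEquivExtension F p _ K rfl).symm⟩

lemma exists_ext (F : Type*) [Field F] [Finite F] (n : ℕ) (hn : n ≠ 0) :
    ∃ (K : Type) (_ : Field K) (_ : Finite K) (_ : Algebra F K), Module.finrank F K = n := by
  let p := ringChar F
  have : CharP F p := ringChar.charP F
  have : Fact p.Prime := ⟨CharP.char_is_prime F p⟩
  have : NeZero n := ⟨hn⟩
  exact ⟨FiniteField.Extension F p n, inferInstance, inferInstance, inferInstance,
    FiniteField.finrank_extension F p n⟩

lemma exists_badType {B : W →ₗ[F] W →ₗ[F] F} (hB : Sympl B) (L : Subgroup Fˣ)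
    {a s : ℕ} (hs : Thr (Nat.card F) a s) (h2 : (2 : F) ≠ 0) (g : simil B L)
    (hg : 2 ^ s ∣ orderOf g) :
    ∃ j, j ≠ 0 ∧ 2 ^ a ∣ j ∧ 2 * j ≤ Module.finrank F W ∧
      ∀ (K : Type) [Field K] [Finite K] [Algebra F K], Module.finrank F K = j →
        badType K s B L g := by
  have hWf : Module.Finite F W := Module.Finite.of_finite
  have hs0 : s ≠ 0 := by
    rintro rfl
    exact hs.nd' (by simp)
  set N := orderOf g with hN
  have hN0 : 0 < N := orderOf_pos g
  have hNe : 2 ∣ N := (dvd_pow_self 2 hs0).trans hg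
  obtain ⟨M, hM⟩ := hNe
  have hM2 : N / 2 = M := by omega
  let G : W →ₗ[F] W := (g.1 : W →ₗ[F] W)
  have hGpow : ∀ n x, (G ^ n) x = (g ^ n).1 x := by
    intro n
    induction n with
    | zero => intro x; simp
    | succ n ih => intro x; rw [pow_succ, Module.End.mul_apply, ih, pow_succ]; rfl
  have hu : (X ^ M + 1 : F[X]) ≠ 0 := by
    have : M ≠ 0 := by omega
    exact (Polynomial.monic_X_pow_add_C (1 : F) this).ne_zero
  have hninj : ¬ Function.Injective (aeval G (X ^ M + 1 : F[X])) := by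
    intro hinj
    have hgM : g ^ M = 1 := by
      ext x
      have h1 : aeval G (X ^ M + 1 : F[X]) ((G ^ M) x - x) = 0 := by
        simp only [map_add, map_pow, aeval_X, map_one, LinearMap.add_apply, Module.End.one_apply,
          map_sub]
        rw [← Module.End.mul_apply, ← pow_add, ← two_mul, ← hM, hGpow N, hN, pow_orderOf_eq_one]
        simp only [OneMemClass.coe_one, LinearEquiv.coe_one, id_eq]
        abel
      have h2 : (G ^ M) x - x = 0 := hinj (by rw [h1, map_zero])
      rw [← hGpow, sub_eq_zero.1 h2]
      rfl
    have := orderOf_dvd_of_pow_eq_one hgM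
    rw [← hN] at this
    have := Nat.le_of_dvd (by omega) this
    omega
  obtain ⟨f, hfirr, hfu, hfn⟩ : ∃ f, Irreducible f ∧ f ∣ (X ^ M + 1 : F[X]) ∧
      ¬ Function.Injective (aeval G f) := by
    by_contra hcon
    push Not at hcon
    exact hninj (inj_of_irred _ hu hcon)
  obtain ⟨v, hv, hv0⟩ : ∃ v, aeval G f v = 0 ∧ v ≠ 0 := by
    by_contra hcon
    push Not at hcon
    apply hfn
    rw [← LinearMap.ker_eq_bot, LinearMap.ker_eq_bot']
    exact hcon
  have : Fact (Irreducible f) := ⟨hfirr⟩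
  have hfr : Module.finrank F (AdjoinRoot f) = f.natDegree := by
    rw [(AdjoinRoot.powerBasis hfirr.ne_zero).finrank, AdjoinRoot.powerBasis_dim]
  have hfin : FiniteDimensional F (AdjoinRoot f) :=
    (AdjoinRoot.powerBasis hfirr.ne_zero).finite
  have main : ∀ (K : Type) [Field K] [Finite K] [Algebra F K], Module.finrank F K = f.natDegree →
        badType K s B L g := by
    intro K _ _ _ hK
    obtain ⟨e⟩ := nonempty_algEquiv (K := K) (K' := AdjoinRoot f) (hfr.trans hK.symm)
    let α := e (AdjoinRoot.root f)
    have hae : ∀ p : F[X], aeval α p = e (AdjoinRoot.mk f p) := by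
      intro p
      have := Polynomial.aeval_algHom_apply (e : AdjoinRoot f →ₐ[F] K) (AdjoinRoot.root f) p
      rw [AdjoinRoot.aeval_eq] at this
      exact this
    have hsurj : Function.Surjective (aeval α : F[X] →ₐ[F] K) := by
      intro x
      obtain ⟨p, hp⟩ := AdjoinRoot.mk_surjective (e.symm x)
      exact ⟨p, by rw [hae, hp, AlgEquiv.apply_symm_apply]⟩
    have hker : ∀ p : F[X], aeval α p = 0 → f ∣ p := by
      intro p hp
      rw [hae, map_eq_zero_iff _ e.injective, AdjoinRoot.mk_eq_zero] at hp
      exact hp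
    have hαf : aeval α f = 0 := by rw [hae, AdjoinRoot.mk_self, map_zero]
    have hαM : α ^ M = -1 := by
      obtain ⟨r, hr⟩ := hfu
      have := congrArg (aeval α) hr
      rw [map_mul, hαf, zero_mul] at this
      simp only [map_add, map_pow, aeval_X, map_one] at this
      exact eq_neg_of_add_eq_zero_left this
    have hα0 : α ≠ 0 := by
      rintro h
      rw [h, zero_pow (by omega)] at hαM
      exact neg_ne_zero.2 one_ne_zero hαM.symm
    have h2K : (2 : K) ≠ 0 := by
      have := (map_ne_zero (algebraMap F K)).2 h2
      rwa [map_ofNat] at this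
    have hbad : bad F s (Units.mk0 α hα0) := by
      constructor
      · rw [Units.val_mk0, Algebra.adjoin_singleton_eq_range_aeval, AlgHom.range_eq_top]
        exact hsurj
      · by_contra hcon
        have h1 : orderOf (Units.mk0 α hα0) ∣ N := by
          rw [orderOf_dvd_iff_pow_eq_one]
          ext
          rw [hM]
          push_cast
          rw [Units.val_mk0, mul_comm 2 M, pow_mul, hαM]
          norm_num
        have h3 := half_dvd h1 hcon hg
        rw [hM2, orderOf_dvd_iff_pow_eq_one] at h3
        have h4 := congrArg Units.val h3
        push_cast at h4
        rw [Units.val_mk0, hαM] at h4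
        apply h2K
        linear_combination -h4
    refine ⟨Units.mk0 α hα0, hbad, ?_⟩
    let φ : F[X] →ₗ[F] K := (aeval α : F[X] →ₐ[F] K).toLinearMap
    let ψ : F[X] →ₗ[F] W := (LinearMap.applyₗ v) ∘ₗ (aeval G : F[X] →ₐ[F] _).toLinearMap
    have hle : LinearMap.ker φ ≤ LinearMap.ker ψ := by
      intro p hp
      obtain ⟨r, rfl⟩ := hker p hp
      rw [LinearMap.mem_ker]
      change aeval G (f * r) v = 0
      rw [mul_comm, map_mul, Module.End.mul_apply, hv, map_zero]
    let ι : K →ₗ[F] W := (LinearMap.ker φ).liftQ ψ hle ∘ₗ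
      (φ.quotKerEquivOfSurjective hsurj).symm.toLinearMap
    have hι : ∀ p : F[X], ι (aeval α p) = aeval G p v := by
      intro p
      have h1 : (φ.quotKerEquivOfSurjective hsurj).symm (aeval α p) = Submodule.Quotient.mk p := by
        rw [LinearEquiv.symm_apply_eq]
        rfl
      change (LinearMap.ker φ).liftQ ψ hle ((φ.quotKerEquivOfSurjective hsurj).symm (aeval α p)) = _
      rw [h1, Submodule.liftQ_apply]
      rfl
    have hιe : ∀ x, ι ((Units.mk0 α hα0 : Kˣ) * x) = G (ι x) := by
      intro x
      obtain ⟨p, rfl⟩ := hsurj x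
      have h1 : ((Units.mk0 α hα0 : Kˣ) : K) * aeval α p = aeval α (X * p) := by
        rw [map_mul, aeval_X, Units.val_mk0]
      rw [h1, hι, hι, map_mul, aeval_X, Module.End.mul_apply]
    refine ⟨ι, eqv_inj hbad hιe ?_, fun x => (hιe x).symm⟩
    intro h0
    apply hv0
    have := hι 1
    rw [h0] at this
    simpa using this.symm
  have hdeg : f.natDegree ≠ 0 := hfirr.natDegree_pos.ne'
  obtain ⟨K, _, _, _, hK⟩ := exists_ext F f.natDegree hdeg
  obtain ⟨α, hα, ι, hι⟩ := main K hK
  refine ⟨f.natDegree, hdeg, ?_, ?_, main⟩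
  · rw [← hK]; exact hα.card_dvd hs
  · rw [← hK]; exact iso_finrank hB ι hι.1 (hι.iso g.2 hs hα)

end thm1
end S16

namespace S16
open Polynomial

lemma hself {F E : Type*} [Field F] [AddCommGroup E] [Module F E] (h2 : (2 : F) ≠ 0) (x : E)
    (hx : x = -x) : x = 0 := by
  have : (2 : F) • x = 0 := by rw [two_smul]; nth_rewrite 2 [hx]; simp
  exact (smul_eq_zero.1 this).resolve_left h2

section par
variable {F K W : Type*} [Field F] [Finite F] [Field K] [Finite K] [Algebra F K]
  [AddCommGroup W] [Module F W] [Finite W]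

/-- the block shape of an element of the parabolic subgroup -/
structure Par (c : Fˣ) (α : Kˣ) (r : W ≃ₗ[F] W) (h : (K × K × W) ≃ₗ[F] (K × K × W)) : Prop where
  top : ∀ x : K, h (x, 0, 0) = ((α : K) * x, 0, 0)
  mid : ∀ v, (h v).2.1 = algebraMap F K c * (α : K)⁻¹ * v.2.1
  bot : ∀ (a : K) (w : W), (h (a, 0, w)).2.2 = r w

lemma Par.one : Par (1 : Fˣ) (1 : Kˣ) (1 : W ≃ₗ[F] W) 1 :=
  ⟨fun x => by simp, fun v => by simp, fun a w => by simp⟩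

lemma Par.mul {c c' : Fˣ} {α α' : Kˣ} {r r' : W ≃ₗ[F] W} {h h' : (K × K × W) ≃ₗ[F] (K × K × W)}
    (H : Par c α r h) (H' : Par c' α' r' h') : Par (c * c') (α * α') (r * r') (h * h') := by
  refine ⟨fun x => ?_, fun v => ?_, fun a w => ?_⟩
  · rw [LinearEquiv.mul_apply, H'.top, H.top, Units.val_mul, mul_assoc]
  · rw [LinearEquiv.mul_apply, H.mid, H'.mid, Units.val_mul, Units.val_mul, map_mul, mul_inv]
    ring
  · have h1 : h' (a, 0, w) = ((h' (a, 0, w)).1, 0, r' w) := by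
      refine Prod.ext rfl (Prod.ext ?_ (H'.bot a w))
      rw [H'.mid]; simp
    rw [LinearEquiv.mul_apply, h1, H.bot, LinearEquiv.mul_apply]

lemma Par.pow {c : Fˣ} {α : Kˣ} {r : W ≃ₗ[F] W} {h : (K × K × W) ≃ₗ[F] (K × K × W)}
    (H : Par c α r h) (n : ℕ) : Par (c ^ n) (α ^ n) (r ^ n) (h ^ n) := by
  induction n with
  | zero => simpa using Par.one
  | succ n ih => simpa only [pow_succ] using ih.mul H

/-- the involution attached to `g` has a `(-1)`-eigenspace of dimension `2 * k` -/
def good {F V : Type*} [Field F] [AddCommGroup V] [Module F V] (k : ℕ) (g : V ≃ₗ[F] V) : Prop :=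
  Even (orderOf g) ∧
    Module.finrank F (LinearMap.ker (((g ^ (orderOf g / 2) : V ≃ₗ[F] V) : V →ₗ[F] V) + 1)) = 2 * k

lemma Par.good {c : Fˣ} {α : Kˣ} {r : W ≃ₗ[F] W} {h : (K × K × W) ≃ₗ[F] (K × K × W)}
    (H : Par c α r h) (h2 : (2 : F) ≠ 0) {a s : ℕ} (hs : Thr (Nat.card F) a s) (hα : bad F s α)
    (hr : ¬ 2 ^ s ∣ orderOf r) : good (Module.finrank F K) h := by
  have hWf : Module.Finite F W := Module.Finite.of_finite
  have hKf : Module.Finite F K := Module.Finite.of_finite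
  have h2K : (2 : K) ≠ 0 := by
    have := (map_ne_zero (algebraMap F K)).2 h2
    rwa [map_ofNat] at this
  have hs0 : s ≠ 0 := by
    rintro rfl
    exact hs.nd' (by simp)
  set N := orderOf h with hN
  have hN0 : 0 < N := orderOf_pos h
  have HN := H.pow N
  rw [hN, pow_orderOf_eq_one] at HN
  rw [← hN] at HN
  have hαN : α ^ N = 1 := by
    have := congrArg Prod.fst (HN.top 1)
    ext
    simpa using this.symm
  have hrN : r ^ N = 1 := by
    ext w
    have := HN.bot 0 w
    simpa using this.symm
  have hcN : c ^ N = 1 := by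
    have := HN.mid (0, 1, 0)
    rw [hαN] at this
    ext
    apply (algebraMap F K).injective
    simpa using this.symm
  have hsN : 2 ^ s ∣ N := hα.2.trans (orderOf_dvd_of_pow_eq_one hαN)
  have hNe : 2 ∣ N := (dvd_pow_self 2 hs0).trans hsN
  refine ⟨even_iff_two_dvd.2 hNe, ?_⟩
  rw [← hN]
  obtain ⟨M, hM⟩ := hNe
  have hM2 : N / 2 = M := by omega
  rw [hM2]
  have hrM : r ^ M = 1 := by
    rw [← orderOf_dvd_iff_pow_eq_one, ← hM2]
    exact half_dvd (orderOf_dvd_of_pow_eq_one hrN) hr hsN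
  have hcM : c ^ M = 1 := by
    rw [← orderOf_dvd_iff_pow_eq_one, ← hM2]
    refine half_dvd (orderOf_dvd_of_pow_eq_one hcN) (fun hd => hs.nd' ?_) hsN
    have := hd.trans (orderOf_dvd_natCard c)
    rwa [Nat.card_units] at this
  have HM := H.pow M
  rw [hrM, hcM] at HM
  set t := h ^ M with ht
  have htt : ∀ v, t (t v) = v := by
    intro v
    rw [← LinearEquiv.mul_apply, ht, ← pow_add, ← two_mul, ← hM, hN, pow_orderOf_eq_one]
    rfl
  have ht1 : t ≠ 1 := by
    intro h1
    have := orderOf_dvd_of_pow_eq_one h1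
    rw [← hN] at this
    have := Nat.le_of_dvd (by omega) this
    omega
  obtain ⟨htop, hmid, hbot⟩ := HM
  have hββ : ((α ^ M : Kˣ) : K) * ((α ^ M : Kˣ) : K) = 1 := by
    rw [← Units.val_mul, ← pow_add, ← two_mul, ← hM, hαN, Units.val_one]
  generalize hβ : ((α ^ M : Kˣ) : K) = β at *
  have hβinv : β⁻¹ = β := inv_eq_of_mul_eq_one_left hββ
  rw [hβinv] at hmid
  simp only [Units.val_one, map_one, one_mul, LinearEquiv.coe_one, id_eq] at hmid hbot
  have hβ1 : β = -1 := by
    rcases mul_self_eq_one_iff.1 hββ with rfl | h1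
    · exfalso
      apply ht1
      have e1 : ∀ v, (t v - v).2.1 = 0 := fun v => by simp [hmid]
      have e2 : ∀ v : K × K × W, v.2.1 = 0 → (t v - v).2.2 = 0 := by
        rintro ⟨x, y, w⟩ h0
        simp only at h0
        subst h0
        simp [hbot]
      have e3 : ∀ v : K × K × W, v.2.1 = 0 → v.2.2 = 0 → t v - v = 0 := by
        rintro ⟨x, y, w⟩ h0 h0'
        simp only at h0 h0'
        subst h0; subst h0'
        simp [htop]
      ext1 v
      have e4 := e3 _ (e1 (t v - v)) (e2 _ (e1 v))
      simp only [map_sub, htt] at e4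
      have e5 : (4 : F) • (t v - v) = 0 := by
        rw [← e4]
        have : (4 : F) = 1 + 1 + 1 + 1 := by norm_num
        rw [this]
        simp only [add_smul, one_smul]
        abel
      have h4 : (4 : F) ≠ 0 := by
        have : (4 : F) = 2 * 2 := by norm_num
        rw [this]; exact mul_ne_zero h2 h2
      exact sub_eq_zero.1 ((smul_eq_zero.1 e5).resolve_left h4)
    · exact h1
  subst hβ1
  let T : (K × K × W) →ₗ[F] (K × K × W) := (t : (K × K × W) →ₗ[F] (K × K × W))
  have hup : Module.finrank F (LinearMap.ker (T + 1)) ≤ 2 * Module.finrank F K := by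
    let f : LinearMap.ker (T + 1) →ₗ[F] K × K :=
      ((LinearMap.fst F K (K × W)).prod (LinearMap.fst F K W ∘ₗ LinearMap.snd F K (K × W))) ∘ₗ
        (LinearMap.ker (T + 1)).subtype
    have hf : Function.Injective f := by
      rw [← LinearMap.ker_eq_bot, LinearMap.ker_eq_bot']
      rintro ⟨⟨x, y, w⟩, hv⟩ h0
      have hx : x = 0 := congrArg Prod.fst h0
      have hy : y = 0 := congrArg Prod.snd h0
      subst hx; subst hy
      have h3 : t (0, 0, w) = - (0, 0, w) := eq_neg_of_add_eq_zero_left hv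
      have h4 := hbot 0 w
      rw [h3] at h4
      have h5 : w = 0 := hself h2 w h4.symm
      subst h5
      rfl
    have := LinearMap.finrank_le_finrank_of_injective hf
    rwa [Module.finrank_prod, ← two_mul] at this
  have hr' : Module.finrank F (LinearMap.range (T + 1)) ≤ Module.finrank F W := by
    let f : LinearMap.range (T + 1) →ₗ[F] W :=
      (LinearMap.snd F K W ∘ₗ LinearMap.snd F K (K × W)) ∘ₗ (LinearMap.range (T + 1)).subtype
    have hf : Function.Injective f := by
      rw [← LinearMap.ker_eq_bot, LinearMap.ker_eq_bot']
      rintro ⟨⟨x, y, w⟩, ⟨v, hv⟩⟩ h0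
      have h3 : t (x, y, w) = (x, y, w) := by
        rw [← hv]
        change t (t v + v) = t v + v
        rw [map_add, htt, add_comm]
      have hw : w = 0 := h0
      subst hw
      have h4 := hmid (x, y, 0)
      rw [h3] at h4
      have hy : y = 0 := hself h2 y (by simpa using h4)
      subst hy
      rw [htop] at h3
      have hx : x = 0 := hself h2 x (by simpa using (congrArg Prod.fst h3).symm)
      subst hx
      rfl
    exact LinearMap.finrank_le_finrank_of_injective hf
  have hrn := LinearMap.finrank_range_add_finrank_ker (T + 1)
  rw [Module.finrank_prod, Module.finrank_prod] at hrn
  change Module.finrank F (LinearMap.ker (T + 1)) = _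
  omega

lemma Par.eqv {c : Fˣ} {α₁ : Kˣ} {r : W ≃ₗ[F] W} {h : (K × K × W) ≃ₗ[F] (K × K × W)}
    (H : Par c α₁ r h) {s : ℕ} (hr : ¬ 2 ^ s ∣ orderOf r) {α : Kˣ} (hα : bad F s α)
    {δ : K →ₗ[F] (K × K × W)} (hδ : ∀ x, h (δ x) = δ (α * x)) (h0 : (δ 1).2.1 = 0) :
    (∀ x, δ x = ((δ x).1, 0, 0)) ∧ ∀ x, (δ (α * x)).1 = α₁ * (δ x).1 := by
  let δ2 : K →ₗ[F] K := (LinearMap.fst F K W ∘ₗ LinearMap.snd F K (K × W)) ∘ₗ δ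
  let δ3 : K →ₗ[F] W := (LinearMap.snd F K W ∘ₗ LinearMap.snd F K (K × W)) ∘ₗ δ
  have e2 : δ2 = 0 := by
    refine eqv_zero hα (Y := LinearMap.mulLeft F (algebraMap F K c * (α₁ : K)⁻¹)) ?_
      one_ne_zero h0
    intro x
    change (δ (α * x)).2.1 = _ * (δ x).2.1
    rw [← hδ, H.mid]
  have e2' : ∀ x, (δ x).2.1 = 0 := fun x => LinearMap.congr_fun e2 x
  have e3' : ∀ x, δ3 (α * x) = r (δ3 x) := by
    intro x
    change (δ (α * x)).2.2 = _
    rw [← hδ]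
    have : δ x = ((δ x).1, 0, δ3 x) := Prod.ext rfl (Prod.ext (e2' x) rfl)
    rw [this, H.bot]
  have e3 : δ3 = 0 := by
    by_contra hne
    have hinj := eqv_inj hα (Y := (r : W →ₗ[F] W)) e3' hne
    apply hr
    refine hα.2.trans (orderOf_dvd_of_pow_eq_one ?_)
    have : ∀ n x, δ3 ((α : K) ^ n * x) = (r ^ n) (δ3 x) := by
      intro n
      induction n with
      | zero => simp
      | succ n ih =>
        intro x
        rw [pow_succ, mul_assoc, ih, e3', pow_succ, LinearEquiv.mul_apply]
    have h1 := this (orderOf r) 1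
    rw [pow_orderOf_eq_one, mul_one] at h1
    ext
    exact hinj h1
  have e4 : ∀ x, δ x = ((δ x).1, 0, 0) := fun x =>
    Prod.ext rfl (Prod.ext (e2' x) (LinearMap.congr_fun e3 x))
  refine ⟨e4, fun x => ?_⟩
  rw [← hδ, e4 x, H.top]

/-- an equivariant nonzero map between two structures on `K` gives conjugacy -/
lemma conj_of_eqv {s : ℕ} {α : Kˣ} (hα : bad F s α) {β : K} {φ : K →ₗ[F] K}
    (hφ : ∀ x, φ (α * x) = β * φ x) (h1 : φ 1 ≠ 0) : ∃ σ : K ≃ₐ[F] K, σ β = α := by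
  apply exists_conj
  have h := eqv_aeval (α := (α : K)) (Y := Algebra.lmul F K β) (φ := φ) hφ (minpoly F β) 1
  rw [Polynomial.aeval_algHom_apply, minpoly.aeval, map_zero, LinearMap.zero_apply, mul_one] at h
  have hinj := eqv_inj hα (Y := Algebra.lmul F K β) hφ (fun h0 => h1 (by rw [h0]; rfl))
  exact hinj (by rw [h, map_zero])

lemma code_card {c : Fˣ} {α₁ : Kˣ} {r : W ≃ₗ[F] W} {h : (K × K × W) ≃ₗ[F] (K × K × W)}
    (H : Par c α₁ r h) {a s : ℕ} (hs : Thr (Nat.card F) a s) (hα₁ : bad F s α₁)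
    (hr : ¬ 2 ^ s ∣ orderOf r) :
    Nat.card {p : Kˣ × (K →ₗ[F] (K × K × W)) // bad F s p.1 ∧ isEq h p.1 p.2} ≤
      2 * Module.finrank F K * (Nat.card K - 1) := by
  classical
  set P := {p : Kˣ × (K →ₗ[F] (K × K × W)) // bad F s p.1 ∧ isEq h p.1 p.2}
  set β : K := algebraMap F K c * (α₁ : K)⁻¹ with hβ
  let C := ((K ≃ₐ[F] K) × Kˣ) ⊕ ((K ≃ₐ[F] K) × Kˣ)
  let R : P → C → Prop := fun p => Sum.elim
    (fun d => (p.1.2 1).2.1 = 0 ∧ (p.1.2 1).1 = d.2 ∧ d.1 α₁ = p.1.1)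
    (fun d => (p.1.2 1).2.1 = d.2 ∧ d.1 β = p.1.1)
  have hex : ∀ p, ∃ d, R p d := by
    rintro ⟨⟨α, ι⟩, hα, hι⟩
    by_cases h0 : (ι 1).2.1 = 0
    · obtain ⟨e1, e2⟩ := H.eqv hr hα hι.2 h0
      have hne : (ι 1).1 ≠ 0 := by
        intro h1
        have := e1 1
        rw [h1] at this
        exact one_ne_zero (hι.1 (this.trans (map_zero ι).symm))
      obtain ⟨σ, hσ⟩ := conj_of_eqv hα (β := (α₁ : K)) (φ := LinearMap.fst F K (K × W) ∘ₗ ι) e2 hne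
      exact ⟨Sum.inl (σ, Units.mk0 _ hne), h0, rfl, hσ⟩
    · obtain ⟨σ, hσ⟩ := conj_of_eqv hα (β := β)
        (φ := (LinearMap.fst F K W ∘ₗ LinearMap.snd F K (K × W)) ∘ₗ ι)
        (fun x => by
          change (ι (α * x)).2.1 = _ * (ι x).2.1
          rw [← hι.2, H.mid]) h0
      exact ⟨Sum.inr (σ, Units.mk0 _ h0), rfl, hσ⟩
  choose f hf using hex
  have hinj : Function.Injective f := by
    rintro ⟨⟨α, ι⟩, hα, hι⟩ ⟨⟨α', ι'⟩, hα', hι'⟩ hff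
    have r1 := hf ⟨⟨α, ι⟩, hα, hι⟩
    have r2 := hf ⟨⟨α', ι'⟩, hα', hι'⟩
    rw [← hff] at r2
    have hδ : ∀ (_ : α = α') (x : K), h ((ι - ι') x) = (ι - ι') (α * x) := by
      rintro rfl x
      simp only [LinearMap.sub_apply, map_sub, hι.2, hι'.2]
    generalize f ⟨⟨α, ι⟩, hα, hι⟩ = d at r1 r2
    rcases d with ⟨σ, u⟩ | ⟨σ, u⟩
    · obtain ⟨a1, a2, a3⟩ := r1
      obtain ⟨b1, b2, b3⟩ := r2
      simp only at a1 a2 a3 b1 b2 b3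
      have hαα : α = α' := Units.ext (a3.symm.trans b3)
      obtain ⟨e1, e2⟩ := H.eqv hr hα (hδ hαα) (by simp [a1, b1])
      have e3 := eqv_zero hα (φ := LinearMap.fst F K (K × W) ∘ₗ (ι - ι'))
        (Y := LinearMap.mulLeft F (α₁ : K)) e2 one_ne_zero (by simp [a2, b2])
      have e4 : ι - ι' = 0 := by
        ext1 x
        rw [e1 x]
        have : ((ι - ι') x).1 = 0 := LinearMap.congr_fun e3 x
        rw [this]; rfl
      rw [sub_eq_zero] at e4
      subst hαα; subst e4; rfl
    · obtain ⟨a2, a3⟩ := r1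
      obtain ⟨b2, b3⟩ := r2
      simp only at a2 a3 b2 b3
      have hαα : α = α' := Units.ext (a3.symm.trans b3)
      obtain ⟨e1, e2⟩ := H.eqv hr hα (hδ hαα) (by simp [a2, b2])
      have e3 : (LinearMap.fst F K (K × W) ∘ₗ (ι - ι')) = 0 := by
        by_contra hne
        have hne1 : (LinearMap.fst F K (K × W) ∘ₗ (ι - ι')) 1 ≠ 0 := fun h0 =>
          hne (eqv_zero hα (Y := LinearMap.mulLeft F (α₁ : K)) e2 one_ne_zero h0)
        obtain ⟨τ, hτ⟩ := conj_of_eqv hα (β := (α₁ : K)) e2 hne1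
        refine hα₁.not_conj hs c (τ.trans σ.symm) ?_
        rw [AlgEquiv.trans_apply, hτ, ← a3, AlgEquiv.symm_apply_apply]
      have e4 : ι - ι' = 0 := by
        ext1 x
        rw [e1 x]
        have : ((ι - ι') x).1 = 0 := LinearMap.congr_fun e3 x
        rw [this]; rfl
      rw [sub_eq_zero] at e4
      subst hαα; subst e4; rfl
  have hc := Nat.card_le_card_of_injective f hinj
  rw [Nat.card_sum, Nat.card_prod, IsGalois.card_aut_eq_finrank, Nat.card_units] at hc
  rw [mul_assoc, two_mul]
  exact hc

end par
end S16

namespace S16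

lemma card_le_of_fiber {A C : Type*} [Finite A] [Finite C] (f : A → C) (M : ℕ)
    (h : ∀ c, Nat.card {a // f a = c} ≤ M) : Nat.card A ≤ Nat.card C * M := by
  classical
  have := Fintype.ofFinite C
  rw [← Nat.card_congr (Equiv.sigmaFiberEquiv f), Nat.card_sigma, Nat.card_eq_fintype_card]
  calc _ ≤ ∑ _c : C, M := Finset.sum_le_sum fun c _ => h c
    _ = _ := by simp

section count
variable {F K W : Type*} [Field F] [Finite F] [Field K] [Finite K] [Algebra F K]
  [AddCommGroup W] [Module F W] [Finite W]

/-- the form on `K × K × W` -/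
noncomputable def BV (K : Type*) [Field K] [Algebra F K] (B : W →ₗ[F] W →ₗ[F] F) :
    (K × K × W) →ₗ[F] (K × K × W) →ₗ[F] F :=
  LinearMap.mk₂ F (fun u v => Algebra.trace F K (u.1 * v.2.1 - u.2.1 * v.1) + B u.2.2 v.2.2)
    (by intro u u' v
        simp only [Prod.fst_add, Prod.snd_add, add_mul, map_sub, map_add, LinearMap.add_apply]; ring)
    (by intro c u v
        simp only [Prod.smul_fst, Prod.smul_snd, smul_mul_assoc, map_sub, map_smul,
          LinearMap.smul_apply, smul_eq_mul]; ring)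
    (by intro u v v'
        simp only [Prod.fst_add, Prod.snd_add, mul_add, map_sub, map_add]; ring)
    (by intro c u v
        simp only [Prod.smul_fst, Prod.smul_snd, mul_smul_comm, map_sub, map_smul,
          smul_eq_mul]; ring)

lemma BV_apply (B : W →ₗ[F] W →ₗ[F] F) (u v : K × K × W) :
    BV K B u v = Algebra.trace F K (u.1 * v.2.1 - u.2.1 * v.1) + B u.2.2 v.2.2 := rfl

lemma trace_nd (x : K) (h : ∀ y : K, Algebra.trace F K (y * x) = 0) : x = 0 := by
  have := (traceForm_nondegenerate F K).1 x
  apply this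
  intro y
  rw [Algebra.traceForm_apply, mul_comm]
  exact h y

lemma BV_sympl {B : W →ₗ[F] W →ₗ[F] F} (hB : Sympl B) : Sympl (BV K B) := by
  constructor
  · intro x
    rw [BV_apply, hB.alt, mul_comm, sub_self, map_zero, add_zero]
  · rintro ⟨x, y, w⟩ h
    have h1 : x = 0 := by
      apply trace_nd (F := F)
      intro z
      have := h (0, z, 0)
      simpa [BV_apply, mul_comm] using this
    have h2 : y = 0 := by
      apply trace_nd (F := F)
      intro z
      have := h (z, 0, 0)
      simpa [BV_apply, mul_comm] using this
    have h3 : w = 0 := by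
      apply hB.nd
      intro z
      have := h (0, 0, z)
      simpa [BV_apply] using this
    rw [h1, h2, h3]; rfl

lemma exists_par {B : W →ₗ[F] W →ₗ[F] F} (hB : Sympl B) {L : Subgroup Fˣ} (h : simil (BV K B) L)
    {α : Kˣ} (hα : ∀ x : K, h.1 (x, 0, 0) = ((α : K) * x, 0, 0)) :
    ∃ (c : Fˣ) (r : simil B L), Par c α r.1 h.1 := by
  have hWf : Module.Finite F W := Module.Finite.of_finite
  obtain ⟨h, c, hcL, hc⟩ := h
  simp only at hα
  have hmid : ∀ v, (h v).2.1 = algebraMap F K c * (α : K)⁻¹ * v.2.1 := by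
    intro v
    have hα0 := α.ne_zero
    have : (α : K) * (h v).2.1 - algebraMap F K c * v.2.1 = 0 := by
      apply trace_nd (F := F)
      intro y
      have := hc (y, 0, 0) v
      rw [hα, BV_apply, BV_apply] at this
      simp only [zero_mul, sub_zero, map_zero, LinearMap.zero_apply, add_zero] at this
      rw [mul_sub, map_sub, sub_eq_zero]
      have e : y * (algebraMap F K c * v.2.1) = (c : F) • (y * v.2.1) := by
        rw [Algebra.smul_def]; ring
      rw [e, map_smul, smul_eq_mul, ← this]
      congr 1; ring
    field_simp
    linear_combination this
  let ρ : W →ₗ[F] W := (LinearMap.snd F K W ∘ₗ LinearMap.snd F K (K × W)) ∘ₗ h.toLinearMap ∘ₗ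
    (LinearMap.inr F K (K × W) ∘ₗ LinearMap.inr F K W)
  have hρ : ∀ w, ρ w = (h (0, 0, w)).2.2 := fun w => rfl
  have hρB : ∀ w w', B (ρ w) (ρ w') = c * B w w' := by
    intro w w'
    have := hc (0, 0, w) (0, 0, w')
    rw [BV_apply, BV_apply, hmid, hmid] at this
    rw [hρ, hρ]
    simpa using this
  have hinj : Function.Injective ρ := by
    rw [← LinearMap.ker_eq_bot, LinearMap.ker_eq_bot']
    intro w hw
    apply hB.nd
    intro w'
    have := hρB w w'
    rw [hw, map_zero, LinearMap.zero_apply] at this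
    exact (mul_eq_zero.1 this.symm).resolve_left c.ne_zero
  refine ⟨c, ⟨LinearEquiv.ofInjectiveEndo ρ hinj, c, hcL, hρB⟩, hα, hmid, fun a w => ?_⟩
  have : ((a, 0, w) : K × K × W) = (a, 0, 0) + (0, 0, w) := by simp
  rw [this, map_add, hα, Prod.snd_add, Prod.snd_add, zero_add]
  rfl

lemma exists_emb {B : W →ₗ[F] W →ₗ[F] F} {L : Subgroup Fˣ} (z : simil B L) :
    ∃ e : simil (BV K B) L, (∀ x : K, e.1 (x, 0, 0) = (x, 0, 0)) ∧
      ∀ w, e.1 (0, 0, w) = (0, 0, z.1 w) := by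
  obtain ⟨z, c, hcL, hc⟩ := z
  let e : (K × K × W) ≃ₗ[F] (K × K × W) := (LinearEquiv.refl F K).prodCongr
    ((LinearEquiv.smulOfUnit c : K ≃ₗ[F] K).prodCongr z)
  have he : ∀ x y w, e (x, y, w) = (x, (c : F) • y, z w) := fun x y w => rfl
  refine ⟨⟨e, c, hcL, ?_⟩, fun x => by simp [he], fun w => by simp [he]⟩
  rintro ⟨x, y, w⟩ ⟨x', y', w'⟩
  rw [he, he, BV_apply, BV_apply]
  simp only [hc, mul_smul_comm, smul_mul_assoc, map_sub, map_smul, smul_eq_mul]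
  ring

lemma exists_diag {B : W →ₗ[F] W →ₗ[F] F} {L : Subgroup Fˣ} (α : Kˣ) :
    ∃ e : simil (BV K B) L, (∀ x : K, e.1 (x, 0, 0) = (α * x, 0, 0)) := by
  let e : (K × K × W) ≃ₗ[F] (K × K × W) := ((LinearEquiv.smulOfUnit α : K ≃ₗ[K] K).restrictScalars F).prodCongr
    (((LinearEquiv.smulOfUnit α⁻¹ : K ≃ₗ[K] K).restrictScalars F).prodCongr (LinearEquiv.refl F W))
  have he : ∀ x y w, e (x, y, w) = (α * x, ((α⁻¹ : Kˣ) : K) * y, w) := fun x y w => rfl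
  refine ⟨⟨e, 1, L.one_mem, ?_⟩, fun x => by simp [he]⟩
  rintro ⟨x, y, w⟩ ⟨x', y', w'⟩
  rw [he, he, BV_apply, BV_apply, Units.val_one, one_mul]
  simp only
  congr 2
  have := Units.mul_inv α
  linear_combination (x * y' - y * x') * this

/-- pointwise stabiliser of the isotropic subspace -/
def XX (B : W →ₗ[F] W →ₗ[F] F) (L : Subgroup Fˣ) (α : Kˣ) (h : simil (BV K B) L) : Prop :=
  ∀ x : K, h.1 (x, 0, 0) = ((α : K) * x, 0, 0)

/-- elements acting as `α` on the isotropic subspace whose middle part has small two-part -/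
def YY (B : W →ₗ[F] W →ₗ[F] F) (L : Subgroup Fˣ) (s : ℕ) (α : Kˣ) (h : simil (BV K B) L) : Prop :=
  XX B L α h ∧ ∃ (c : Fˣ) (r : simil B L), Par c α r.1 h.1 ∧ ¬ 2 ^ s ∣ orderOf r

lemma card_YY {B : W →ₗ[F] W →ₗ[F] F} (hB : Sympl B) (L : Subgroup Fˣ) (s : ℕ) (α : Kˣ) :
    Nat.card {h // XX (K := K) B L 1 h} * Nat.card {r : simil B L // ¬ 2 ^ s ∣ orderOf r} ≤
      Nat.card {h // YY B L s α h} * Nat.card (simil B L) := by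
  obtain ⟨d, hd⟩ := exists_diag (B := B) (L := L) α
  choose emb hemb1 hemb2 using exists_emb (B := B) (L := L) (K := K)
  have hX : ∀ h : {h // XX (K := K) B L 1 h}, ∀ x : K, (h.1 * d).1 (x, 0, 0) = (α * x, 0, 0) := by
    intro h x
    rw [Subgroup.coe_mul, LinearEquiv.mul_apply, hd, h.2]
    simp
  choose c r hr using fun h : {h // XX (K := K) B L 1 h} => exists_par hB (h.1 * d) (hX h)
  have hres : ∀ h y w, ((h.1 * d * emb ((r h)⁻¹ * y)).1 (0, 0, w)).2.2 = y.1 w := by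
    intro h y w
    rw [Subgroup.coe_mul, LinearEquiv.mul_apply, hemb2, (hr h).bot, ← LinearEquiv.mul_apply,
      ← Subgroup.coe_mul, mul_inv_cancel_left]
  have hXX : ∀ h y, XX B L α (h.1 * d * emb ((r h)⁻¹ * y)) := by
    intro h y x
    rw [Subgroup.coe_mul, LinearEquiv.mul_apply, hemb1, hX]
  have hY : ∀ h, ∀ y : {r : simil B L // ¬ 2 ^ s ∣ orderOf r},
      YY B L s α (h.1 * d * emb ((r h)⁻¹ * y.1)) := by
    intro h y
    refine ⟨hXX h y.1, ?_⟩
    obtain ⟨c', r', hr'⟩ := exists_par hB _ (hXX h y.1)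
    refine ⟨c', r', hr', ?_⟩
    have : r' = y.1 := by
      ext w
      rw [← hr'.bot 0 w, hres]
    rw [this]
    exact y.2
  rw [← Nat.card_prod, ← Nat.card_prod]
  refine Nat.card_le_card_of_injective (fun p => (⟨_, hY p.1 p.2⟩, r p.1)) ?_
  rintro ⟨h, y⟩ ⟨h', y'⟩ hh
  have e1 := congrArg (fun z => z.1.1) hh
  have e2 : r h = r h' := congrArg Prod.snd hh
  simp only at e1
  have e3 : y = y' := by
    ext w
    rw [← hres h y.1 w, e1, hres]
  subst e3
  rw [e2] at e1
  have e4 : h = h' := Subtype.ext (mul_right_cancel (mul_right_cancel e1))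
  rw [e4]

lemma finrank_ker_conj {F V V' : Type*} [Field F] [AddCommGroup V] [Module F V] [AddCommGroup V']
    [Module F V'] (e : V ≃ₗ[F] V') (S : V →ₗ[F] V) (T : V' →ₗ[F] V')
    (h : ∀ x, T (e x) = e (S x)) : Module.finrank F (LinearMap.ker (T + 1)) =
      Module.finrank F (LinearMap.ker (S + 1)) := by
  have : LinearMap.ker (T + 1) = (LinearMap.ker (S + 1)).map (e : V →ₗ[F] V') := by
    ext y
    rw [Submodule.mem_map_equiv, LinearMap.mem_ker, LinearMap.mem_ker]
    obtain ⟨x, rfl⟩ := e.surjective y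
    rw [LinearEquiv.symm_apply_apply, LinearMap.add_apply, h, Module.End.one_apply, ← map_add,
      LinearEquiv.map_eq_zero_iff]
    rfl
  rw [this, LinearEquiv.finrank_map_eq]

lemma good_conj {V : Type*} [AddCommGroup V] [Module F V] [Finite V] {k : ℕ} {g h : V ≃ₗ[F] V}
    (hh : good k h) : good k (g * h * g⁻¹) := by
  have ho : orderOf (g * h * g⁻¹) = orderOf h := by
    rw [← MulAut.conj_apply, MulEquiv.orderOf_eq]
  obtain ⟨h1, h2⟩ := hh
  refine ⟨by rwa [ho], ?_⟩
  rw [ho, ← h2, conj_pow]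
  refine finrank_ker_conj g _ _ fun x => ?_
  rw [LinearEquiv.coe_coe, LinearEquiv.coe_coe, LinearEquiv.mul_apply, LinearEquiv.mul_apply,
    ← LinearEquiv.mul_apply g⁻¹ g, inv_mul_cancel]
  rfl

lemma good_card {B : W →ₗ[F] W →ₗ[F] F} (hB : Sympl B) (L : Subgroup Fˣ) (h2 : (2 : F) ≠ 0)
    {a s : ℕ} (hs : Thr (Nat.card F) a s) :
    Nat.card {α : Kˣ // bad F s α} * Nat.card (simil (BV K B) L) *
      Nat.card {r : simil B L // ¬ 2 ^ s ∣ orderOf r} ≤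
    Nat.card {g : simil (BV K B) L // good (Module.finrank F K) g.1} *
      (2 * Module.finrank F K * (Nat.card K - 1)) * Nat.card (simil B L) := by
  set G := simil (BV K B) L
  set St := {h // XX (K := K) B L 1 h}
  let T := Σ p : G × {α : Kˣ // bad F s α}, {h // YY B L s p.2.1 h}
  have hSt : 0 < Nat.card St := by
    have : Nonempty St := ⟨1, fun x => by simp⟩
    exact Nat.card_pos
  have hT1 : Nat.card {α : Kˣ // bad F s α} * Nat.card G * (Nat.card St *
      Nat.card {r : simil B L // ¬ 2 ^ s ∣ orderOf r}) ≤ Nat.card T * Nat.card (simil B L) := by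
    have := Fintype.ofFinite (G × {α : Kˣ // bad F s α})
    rw [Nat.card_sigma, Finset.sum_mul]
    calc _ = ∑ _p : G × {α : Kˣ // bad F s α}, (Nat.card St *
      Nat.card {r : simil B L // ¬ 2 ^ s ∣ orderOf r}) := by
          rw [Finset.sum_const, Finset.card_univ, ← Nat.card_eq_fintype_card, Nat.card_prod,
            smul_eq_mul, mul_comm (Nat.card G)]
      _ ≤ _ := Finset.sum_le_sum fun p _ => card_YY hB L s p.2.1
  have hT2 : Nat.card T ≤ Nat.card {g : G // good (Module.finrank F K) g.1} *
      (2 * Module.finrank F K * (Nat.card K - 1) * Nat.card St) := by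
    have hgood : ∀ t : T, good (Module.finrank F K) (t.1.1 * t.2.1 * t.1.1⁻¹).1 := by
      rintro ⟨⟨g, α, hα⟩, h, -, c, r, hp, hr⟩
      refine good_conj (hp.good h2 hs hα ?_)
      rwa [Subgroup.orderOf_coe]
    refine card_le_of_fiber
      (fun t : T => (⟨_, hgood t⟩ : {g : G // good (Module.finrank F K) g.1})) _ ?_
    rintro ⟨γ, hγ⟩
    set Fib := {t : T // (⟨_, hgood t⟩ : {g : G // good (Module.finrank F K) g.1}) = ⟨γ, hγ⟩}
    have hFib : ∀ t : Fib, t.1.1.1 * t.1.2.1 * t.1.1.1⁻¹ = γ := fun t => congrArg Subtype.val t.2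
    rcases isEmpty_or_nonempty Fib with hE | ⟨⟨t1⟩⟩
    · simp
    obtain ⟨hX1, c, r, hp, hr⟩ := t1.1.2.2
    have hr' : ¬ 2 ^ s ∣ orderOf r.1 := by rwa [Subgroup.orderOf_coe]
    have hcode := code_card hp hs t1.1.1.2.2 hr'
    set h1 := t1.1.2.1
    set g1 := t1.1.1.1
    let P := {p : Kˣ × (K →ₗ[F] (K × K × W)) // bad F s p.1 ∧ isEq h1.1 p.1 p.2}
    have hrel : ∀ t : Fib, h1 * (g1⁻¹ * t.1.1.1) = (g1⁻¹ * t.1.1.1) * t.1.2.1 := by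
      intro t
      have e1 : t.1.1.1 * t.1.2.1 * t.1.1.1⁻¹ = g1 * h1 * g1⁻¹ := (hFib t).trans (hFib t1).symm
      rw [mul_inv_eq_iff_eq_mul] at e1
      rw [mul_assoc, e1]
      group
    let ι : Fib → (K →ₗ[F] (K × K × W)) := fun t =>
      ((g1⁻¹ * t.1.1.1).1 : (K × K × W) →ₗ[F] (K × K × W)) ∘ₗ LinearMap.inl F K (K × W)
    have hι : ∀ t x, ι t x = (g1⁻¹ * t.1.1.1).1 (x, 0, 0) := fun t x => rfl
    have hιe : ∀ t : Fib, isEq h1.1 t.1.1.2.1 (ι t) := by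
      intro t
      constructor
      · intro x y hxy
        rw [hι, hι] at hxy
        exact congrArg Prod.fst ((g1⁻¹ * t.1.1.1).1.injective hxy)
      · intro x
        rw [hι, hι, ← LinearEquiv.mul_apply, ← Subgroup.coe_mul, hrel, Subgroup.coe_mul,
          LinearEquiv.mul_apply, t.1.2.2.1]
    refine (card_le_of_fiber (fun t : Fib =>
      (⟨(t.1.1.2.1, ι t), t.1.1.2.2, hιe t⟩ : P)) (Nat.card St) ?_).trans
      (Nat.mul_le_mul_right _ hcode)
    rintro ⟨⟨α, j⟩, hαj⟩
    set Fib2 := {t : Fib // (⟨(t.1.1.2.1, ι t), t.1.1.2.2, hιe t⟩ : P) = ⟨(α, j), hαj⟩}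
    rcases isEmpty_or_nonempty Fib2 with hE | ⟨⟨t2⟩⟩
    · simp
    have hj : ∀ t : Fib2, ι t.1 = j := fun t => congrArg (fun z => z.1.2) t.2
    have hα : ∀ t : Fib2, t.1.1.1.2.1 = α := fun t => congrArg (fun z => z.1.1) t.2
    refine Nat.card_le_card_of_injective (fun t : Fib2 =>
      (⟨t2.1.1.1.1⁻¹ * t.1.1.1.1, fun x => ?_⟩ : St)) ?_
    · have e1 := LinearMap.congr_fun ((hj t).trans (hj t2).symm) x
      rw [hι, hι, Subgroup.coe_mul, Subgroup.coe_mul, LinearEquiv.mul_apply,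
        LinearEquiv.mul_apply] at e1
      have e2 := (g1⁻¹).1.injective e1
      rw [Subgroup.coe_mul, LinearEquiv.mul_apply, e2, ← LinearEquiv.mul_apply,
        ← Subgroup.coe_mul, inv_mul_cancel]
      simp
    · intro t t' htt
      have e1 : t.1.1.1.1 = t'.1.1.1.1 := mul_left_cancel (congrArg Subtype.val htt)
      have e2 : t.1.1.1.2 = t'.1.1.1.2 := Subtype.ext ((hα t).trans (hα t').symm)
      have e3 : t.1.1.2.1 = t'.1.1.2.1 := by
        have f1 := hrel t.1
        rw [e1, hrel t'.1] at f1
        exact (mul_left_cancel f1).symm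
      apply Subtype.ext
      apply Subtype.ext
      obtain ⟨⟨⟨⟨g, α⟩, h⟩, _⟩, _⟩ := t
      obtain ⟨⟨⟨⟨g', α'⟩, h'⟩, _⟩, _⟩ := t'
      simp only at e1 e2 e3 ⊢
      subst e1
      subst e2
      rw [Subtype.ext e3]
  have := hT1.trans (Nat.mul_le_mul_right _ hT2)
  refine Nat.le_of_mul_le_mul_right ?_ hSt
  calc _ = _ := by ring
    _ ≤ _ := this
    _ = _ := by ring

end count
end S16

namespace S16

section notbad
variable {F W : Type*} [Field F] [Finite F] [AddCommGroup W] [Module F W] [Finite W]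

lemma notbad_card {B : W →ₗ[F] W →ₗ[F] F} (hB : Sympl B) (L : Subgroup Fˣ) (h2 : (2 : F) ≠ 0)
    {a s m : ℕ} (hs : Thr (Nat.card F) a s) (hdim : Module.finrank F W = 2 * m)
    (hm : ((harmonic (m / 2 ^ a) : ℚ) : ℝ) ≤ 2 ^ a / 2) :
    Nat.card (simil B L) ≤ 2 * Nat.card {r : simil B L // ¬ 2 ^ s ∣ orderOf r} := by
  classical
  have := Fintype.ofFinite (simil B L)
  set n := m / 2 ^ a with hn
  choose K hK1 hK2 hK3 hK4 using fun i : ℕ => exists_ext F (2 ^ a * (i + 1)) (by positivity)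
  let S : ℕ → Finset (simil B L) := fun i =>
    Finset.univ.filter fun g => badType (K i) s B L g
  let T : Finset (simil B L) := Finset.univ.filter fun g => 2 ^ s ∣ orderOf g
  have hTS : T ⊆ (Finset.range n).biUnion S := by
    intro g hg
    obtain ⟨j, hj0, ⟨i, rfl⟩, hj2, hj⟩ := exists_badType hB L hs h2 g (Finset.mem_filter.1 hg).2
    have hi : i ≠ 0 := by rintro rfl; simp at hj0
    obtain ⟨i, rfl⟩ := Nat.exists_eq_succ_of_ne_zero hi
    rw [Finset.mem_biUnion]
    refine ⟨i, ?_, Finset.mem_filter.2 ⟨Finset.mem_univ _, hj (K i) (hK4 i)⟩⟩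
    rw [Finset.mem_range, hn, Nat.lt_iff_add_one_le, Nat.le_div_iff_mul_le (by positivity)]
    rw [hdim] at hj2
    have : 2 ^ a * i.succ = (i + 1) * 2 ^ a := mul_comm _ _
    omega
  have hS : ∀ i, ((S i).card : ℝ) ≤ Nat.card (simil B L) / 2 ^ a * ((i : ℝ) + 1)⁻¹ := by
    intro i
    have h := badType_card (K := K i) hB L hs
    rw [hK4, Nat.card_eq_fintype_card, Fintype.card_subtype] at h
    change (S i).card * _ ≤ _ at h
    have h' : ((S i).card : ℝ) * (2 ^ a * (i + 1)) ≤ Nat.card (simil B L) := by exact_mod_cast h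
    rw [div_mul_eq_mul_div, le_div_iff₀ (by positivity), ← div_eq_mul_inv, le_div_iff₀ (by positivity)]
    linarith
  have hT : (T.card : ℝ) ≤ Nat.card (simil B L) / 2 := by
    calc (T.card : ℝ) ≤ ((Finset.range n).biUnion S).card := by
          exact_mod_cast Finset.card_le_card hTS
      _ ≤ ∑ i ∈ Finset.range n, ((S i).card : ℝ) := by exact_mod_cast Finset.card_biUnion_le
      _ ≤ ∑ i ∈ Finset.range n, Nat.card (simil B L) / 2 ^ a * ((i : ℝ) + 1)⁻¹ :=
          Finset.sum_le_sum fun i _ => hS i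
      _ = Nat.card (simil B L) / 2 ^ a * ((harmonic n : ℚ) : ℝ) := by
          rw [← Finset.mul_sum, harmonic]
          push_cast
          rfl
      _ ≤ Nat.card (simil B L) / 2 ^ a * (2 ^ a / 2) := by gcongr
      _ = _ := by field_simp
  have hc : T.card + Nat.card {r : simil B L // ¬ 2 ^ s ∣ orderOf r} = Nat.card (simil B L) := by
    rw [Nat.card_eq_fintype_card, Fintype.card_subtype, Finset.card_filter_add_card_filter_not,
      Nat.card_eq_fintype_card, Finset.card_univ]
  have hc' : (T.card : ℝ) + Nat.card {r : simil B L // ¬ 2 ^ s ∣ orderOf r} =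
    Nat.card (simil B L) := by exact_mod_cast hc
  have : (Nat.card (simil B L) : ℝ) ≤ 2 * Nat.card {r : simil B L // ¬ 2 ^ s ∣ orderOf r} := by
    linarith
  exact_mod_cast this

/-- proportion of good elements, split form -/
lemma good_prop {K : Type*} [Field K] [Finite K] [Algebra F K] {B : W →ₗ[F] W →ₗ[F] F}
    (hB : Sympl B) (L : Subgroup Fˣ) (h2 : (2 : F) ≠ 0)
    {a s m : ℕ} (hs : Thr (Nat.card F) a s) (hdim : Module.finrank F W = 2 * m)
    (hm : ((harmonic (m / 2 ^ a) : ℚ) : ℝ) ≤ 2 ^ a / 2) (hk : 2 ^ a ∣ Module.finrank F K) :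
    Nat.card (simil (BV K B) L) ≤
      16 * Module.finrank F K * Nat.card {g : simil (BV K B) L // good (Module.finrank F K) g.1} := by
  have h1 := notbad_card hB L h2 hs hdim hm
  have h3 := good_card (K := K) hB L h2 hs
  have h4 := card_bad (F := F) (K := K) hs hk
  have h5 : 0 < Nat.card K - 1 := by
    have := Finite.one_lt_card (α := K)
    omega
  have h6 : 0 < Nat.card (simil B L) := Nat.card_pos
  refine Nat.le_of_mul_le_mul_right ?_ (Nat.mul_pos h5 h6)
  set G := Nat.card (simil (BV K B) L)
  set GW := Nat.card (simil B L)
  set k := Module.finrank F K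
  set Q := Nat.card K - 1
  calc G * (Q * GW) ≤ G * ((4 * Nat.card {α : Kˣ // bad F s α}) *
        (2 * Nat.card {r : simil B L // ¬ 2 ^ s ∣ orderOf r})) := by gcongr
    _ = 8 * (Nat.card {α : Kˣ // bad F s α} * G *
        Nat.card {r : simil B L // ¬ 2 ^ s ∣ orderOf r}) := by ring
    _ ≤ 8 * _ := Nat.mul_le_mul_left _ h3
    _ = _ := by ring

end notbad
end S16

namespace S16

section std

/-- the standard alternating form -/
noncomputable def stdB (F ι : Type*) [Field F] [Fintype ι] :
    (ι ⊕ ι → F) →ₗ[F] (ι ⊕ ι → F) →ₗ[F] F :=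
  LinearMap.mk₂ F (fun u v => ∑ i, (u (Sum.inl i) * v (Sum.inr i) - u (Sum.inr i) * v (Sum.inl i)))
    (by intro u u' v
        rw [← Finset.sum_add_distrib]
        exact Finset.sum_congr rfl fun i _ => by simp only [Pi.add_apply]; ring)
    (by intro c u v
        rw [smul_eq_mul, Finset.mul_sum]
        exact Finset.sum_congr rfl fun i _ => by simp only [Pi.smul_apply, smul_eq_mul]; ring)
    (by intro u v v'
        rw [← Finset.sum_add_distrib]
        exact Finset.sum_congr rfl fun i _ => by simp only [Pi.add_apply]; ring)
    (by intro c u v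
        rw [smul_eq_mul, Finset.mul_sum]
        exact Finset.sum_congr rfl fun i _ => by simp only [Pi.smul_apply, smul_eq_mul]; ring)

lemma stdB_apply {F ι : Type*} [Field F] [Fintype ι] (u v : ι ⊕ ι → F) : stdB F ι u v =
    ∑ i, (u (Sum.inl i) * v (Sum.inr i) - u (Sum.inr i) * v (Sum.inl i)) := rfl

lemma stdB_sympl (F ι : Type*) [Field F] [Fintype ι] [DecidableEq ι] : Sympl (stdB F ι) := by
  constructor
  · intro x
    rw [stdB_apply]
    exact Finset.sum_eq_zero fun i _ => by ring
  · intro x h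
    ext j
    rcases j with j | j
    · have := h (Pi.single (Sum.inr j) 1)
      rw [stdB_apply] at this
      simpa [Pi.single_apply] using this
    · have := h (Pi.single (Sum.inl j) 1)
      rw [stdB_apply] at this
      simpa [Pi.single_apply] using this

lemma exists_isometry {F K : Type*} [Field F] [Finite F] [Field K] [Finite K] [Algebra F K]
    {k m : ℕ} (hk : Module.finrank F K = k) :
    ∃ e : (Fin (k + m) ⊕ Fin (k + m) → F) ≃ₗ[F] (K × K × (Fin m ⊕ Fin m → F)),
      ∀ u v, BV K (stdB F (Fin m)) (e u) (e v) = stdB F (Fin (k + m)) u v := by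
  have hKf : Module.Finite F K := Module.Finite.of_finite
  let b : Module.Basis (Fin k) F K := Module.finBasisOfFinrankEq F K hk
  let b' := b.traceDual
  let f1 : (Fin (k + m) ⊕ Fin (k + m) → F) →ₗ[F] K :=
    ∑ i, (LinearMap.proj (Sum.inl (Fin.castAdd m i)) : _ →ₗ[F] F).smulRight (b i)
  let f2 : (Fin (k + m) ⊕ Fin (k + m) → F) →ₗ[F] K :=
    ∑ i, (LinearMap.proj (Sum.inr (Fin.castAdd m i)) : _ →ₗ[F] F).smulRight (b' i)
  let f3 : (Fin (k + m) ⊕ Fin (k + m) → F) →ₗ[F] (Fin m ⊕ Fin m → F) :=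
    LinearMap.funLeft F F (Sum.map (Fin.natAdd k) (Fin.natAdd k))
  let f := f1.prod (f2.prod f3)
  have htr : ∀ u v, Algebra.trace F K (f1 u * f2 v) =
      ∑ i, u (Sum.inl (Fin.castAdd m i)) * v (Sum.inr (Fin.castAdd m i)) := by
    intro u v
    simp only [f1, f2, LinearMap.sum_apply, LinearMap.smulRight_apply, LinearMap.proj_apply,
      Finset.sum_mul_sum, smul_mul_smul_comm, map_sum, map_smul, smul_eq_mul]
    refine Finset.sum_congr rfl fun i _ => ?_
    simp [b', Module.Basis.trace_mul_traceDual]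
  have hf : ∀ u v, BV K (stdB F (Fin m)) (f u) (f v) = stdB F (Fin (k + m)) u v := by
    intro u v
    rw [BV_apply, stdB_apply, stdB_apply, Fin.sum_univ_add]
    congr 1
    change Algebra.trace F K (f1 u * f2 v - f2 u * f1 v) = _
    rw [map_sub, mul_comm (f2 u), htr, htr, ← Finset.sum_sub_distrib]
    exact Finset.sum_congr rfl fun i _ => by ring
  have hinj : Function.Injective f := by
    rw [← LinearMap.ker_eq_bot, LinearMap.ker_eq_bot']
    intro u hu
    apply (stdB_sympl F (Fin (k + m))).nd
    intro v
    rw [← hf, hu, map_zero, LinearMap.zero_apply]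
  refine ⟨LinearEquiv.ofInjectiveOfFinrankEq f hinj ?_, hf⟩
  simp [Module.finrank_prod, hk]
  ring

lemma good_transfer {F V V' : Type*} [Field F] [AddCommGroup V] [Module F V] [AddCommGroup V']
    [Module F V'] (e : V ≃ₗ[F] V') {B : V →ₗ[F] V →ₗ[F] F} {B' : V' →ₗ[F] V' →ₗ[F] F}
    (he : ∀ u v, B' (e u) (e v) = B u v) (L : Subgroup Fˣ) (k : ℕ) :
    Nat.card (simil B L) = Nat.card (simil B' L) ∧
    Nat.card {g : simil B L // good k g.1} = Nat.card {g : simil B' L // good k g.1} := by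
  let φ : (V ≃ₗ[F] V) ≃* (V' ≃ₗ[F] V') :=
    { toFun := fun g => (e.symm.trans g).trans e
      invFun := fun g => (e.trans g).trans e.symm
      left_inv := fun g => by ext; simp
      right_inv := fun g => by ext; simp
      map_mul' := fun g h => by ext; simp }
  have hφ : ∀ g x, φ g (e x) = e (g x) := fun g x => by simp [φ]
  have hmem : ∀ g, g ∈ simil B L ↔ φ g ∈ simil B' L := by
    intro g
    rw [mem_simil, mem_simil]
    constructor
    · rintro ⟨c, hc, h⟩
      refine ⟨c, hc, fun u v => ?_⟩
      obtain ⟨u, rfl⟩ := e.surjective u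
      obtain ⟨v, rfl⟩ := e.surjective v
      rw [hφ, hφ, he, he, h]
    · rintro ⟨c, hc, h⟩
      refine ⟨c, hc, fun u v => ?_⟩
      rw [← he, ← hφ, ← hφ, h, he]
  have hgood : ∀ g, good k g ↔ good k (φ g) := by
    intro g
    rw [good, good, MulEquiv.orderOf_eq, ← map_pow]
    rw [finrank_ker_conj e _ _ (hφ (g ^ (orderOf g / 2)))]
  let E : simil B L ≃ simil B' L := φ.toEquiv.subtypeEquiv hmem
  exact ⟨Nat.card_congr E, Nat.card_congr (E.subtypeEquiv fun g => hgood g.1)⟩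

lemma good_std {F : Type*} [Field F] [Finite F] (h2 : (2 : F) ≠ 0) (L : Subgroup Fˣ)
    {a s l k : ℕ} (hs : Thr (Nat.card F) a s) (hk0 : k ≠ 0) (hk : 2 ^ a ∣ k) (hkl : k ≤ l)
    (hm : ((harmonic ((l - k) / 2 ^ a) : ℚ) : ℝ) ≤ 2 ^ a / 2) :
    Nat.card (simil (stdB F (Fin l)) L) ≤
      16 * k * Nat.card {g : simil (stdB F (Fin l)) L // good k g.1} := by
  obtain ⟨m, rfl⟩ := Nat.exists_eq_add_of_le hkl
  obtain ⟨K, _, _, _, hK⟩ := exists_ext F k hk0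
  obtain ⟨e, he⟩ := exists_isometry (m := m) hK
  obtain ⟨h3, h4⟩ := good_transfer e he L k
  rw [h3, h4]
  rw [Nat.add_sub_cancel_left] at hm
  have := good_prop (K := K) (stdB_sympl F (Fin m)) L h2 hs (by simp; ring) hm (by rwa [hK])
  rwa [hK] at this

end std
end S16

namespace S16

lemma exists_simil {F V : Type*} [Field F] [AddCommGroup V] [Module F V]
    (B : V →ₗ[F] V →ₗ[F] F) (H : Subgroup (V ≃ₗ[F] V)) (h1 : simil B ⊥ ≤ H)
    (h2 : H ≤ simil B ⊤) : ∃ L, H = simil B L := by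
  let L : Subgroup Fˣ :=
    { carrier := {c | ∃ g ∈ H, ∀ u v, B (g u) (g v) = (c : F) * B u v}
      mul_mem' := by
        rintro c d ⟨g, hg, hg'⟩ ⟨h, hh, hh'⟩
        refine ⟨g * h, H.mul_mem hg hh, fun u v => ?_⟩
        simp only [LinearEquiv.mul_apply, hg', hh', Units.val_mul, mul_assoc]
      one_mem' := ⟨1, H.one_mem, fun u v => by simp⟩
      inv_mem' := by
        rintro c ⟨g, hg, hg'⟩
        refine ⟨g⁻¹, H.inv_mem hg, fun u v => ?_⟩
        have := hg' (g⁻¹ u) (g⁻¹ v)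
        have e : ∀ u, g (g⁻¹ u) = u := fun u => LinearEquiv.apply_symm_apply g u
        rw [e, e] at this
        rw [this]
        simp }
  refine ⟨L, le_antisymm ?_ ?_⟩
  · intro g hg
    obtain ⟨c, -, hc⟩ := h2 hg
    exact ⟨c, ⟨g, hg, hc⟩, hc⟩
  · rintro g ⟨c, ⟨g', hg', hc'⟩, hc⟩
    have : g * g'⁻¹ ∈ H := by
      apply h1
      refine ⟨1, Subgroup.one_mem _, fun u v => ?_⟩
      have e : ∀ u, g' (g'⁻¹ u) = u := fun u => LinearEquiv.apply_symm_apply g' u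
      rw [LinearEquiv.mul_apply, LinearEquiv.mul_apply, hc, ← hc', e, e]
      simp
    simpa using H.mul_mem this hg'

lemma good_sum {F V : Type*} [Field F] [AddCommGroup V] [Module F V] [Finite V]
    (G : Subgroup (V ≃ₗ[F] V)) (y : ℕ) (hy : 0 < y) (n : ℕ)
    (h : ∀ i < n, Nat.card G ≤ 16 * (y * (i + 1)) * Nat.card {g : G // good (y * (i + 1)) g.1}) :
    (Nat.card G : ℝ) * (((harmonic n : ℚ) : ℝ) / (16 * y)) ≤
      Nat.card {g : G // ∃ i < n, good (y * (i + 1)) g.1} := by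
  classical
  have := Fintype.ofFinite G
  let S : ℕ → Finset G := fun i => Finset.univ.filter fun g => good (y * (i + 1)) g.1
  have hU : Nat.card {g : G // ∃ i < n, good (y * (i + 1)) g.1} =
      ((Finset.range n).biUnion S).card := by
    rw [Nat.card_eq_fintype_card, Fintype.card_subtype]
    congr 1
    ext g
    simp [S]
  have hd : ((Finset.range n).biUnion S).card = ∑ i ∈ Finset.range n, (S i).card := by
    apply Finset.card_biUnion
    intro i _ j _ hij
    change Disjoint (S i) (S j)
    rw [Finset.disjoint_left]
    intro g hg hg'
    have h1 := (Finset.mem_filter.1 hg).2.2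
    have h2 := (Finset.mem_filter.1 hg').2.2
    rw [h1] at h2
    have h3 : y * (i + 1) = y * (j + 1) := by omega
    have := Nat.eq_of_mul_eq_mul_left hy h3
    omega
  rw [hU, hd, harmonic]
  push_cast
  rw [Finset.sum_div, Finset.mul_sum]
  refine Finset.sum_le_sum fun i hi => ?_
  have h1 := h i (Finset.mem_range.1 hi)
  rw [Nat.card_eq_fintype_card (α := {g : G // good (y * (i + 1)) g.1}), Fintype.card_subtype] at h1
  change _ ≤ _ * (S i).card at h1
  have h2 : (Nat.card G : ℝ) ≤ 16 * (y * (i + 1)) * (S i).card := by exact_mod_cast h1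
  have hy' : (0 : ℝ) < y := by exact_mod_cast hy
  have : (Nat.card G : ℝ) * (((i : ℝ) + 1)⁻¹ / (16 * y)) = Nat.card G / (16 * (y * (i + 1))) := by
    field_simp
  rw [this, div_le_iff₀ (by positivity)]
  linarith

lemma one_lt_log_three : (1 : ℝ) < Real.log 3 := by
  rw [Real.lt_log_iff_exp_lt (by norm_num)]
  have := Real.exp_one_lt_d9
  linarith

lemma analytic (ε : ℝ) (hε : ε ∈ Set.Ioo (0 : ℝ) 1) (l : ℕ)
    (h1 : ⌈(Real.log l + 1) ^ 2⌉ < ⌈(l : ℝ) ^ ε⌉)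
    (h2 : ⌈(l : ℝ) ^ ε⌉ ≤ (l : ℤ) - 2 * ⌈Real.log l⌉) :
    ∃ L a : ℕ, ⌈(l : ℝ) ^ ε⌉ = (L : ℤ) ∧ L ≤ l ∧ 2 ≤ a ∧
      (∀ m ≤ l, ((harmonic (m / 2 ^ a) : ℚ) : ℝ) ≤ 2 ^ a / 2) ∧
      ε / 768 < ((harmonic (L / 2 ^ a) : ℚ) : ℝ) / (16 * 2 ^ a) := by
  obtain ⟨hε0, hε1⟩ := hε
  have hl3 : 3 ≤ l := by
    by_contra hcon
    have hl : l = 0 ∨ l = 1 ∨ l = 2 := by omega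
    rcases hl with rfl | rfl | rfl
    · simp [Real.zero_rpow hε0.ne'] at h1
    · simp at h1
    · have p1 : 0 < ⌈Real.log (2 : ℕ)⌉ := Int.ceil_pos.2 (Real.log_pos (by norm_num))
      have p2 : 0 ≤ ⌈(Real.log (2 : ℕ) + 1) ^ 2⌉ := Int.ceil_nonneg (by positivity)
      push_cast at h2
      push_cast at p1
      push_cast at p2
      push_cast at h1
      omega
  set x := Real.log l with hx
  have hl0 : (0 : ℝ) < l := by
    have : 0 < l := by omega
    exact_mod_cast this
  have hx1 : 1 < x := one_lt_log_three.trans_le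
    (Real.log_le_log (by norm_num) (by exact_mod_cast hl3))
  have hLnn : 0 ≤ ⌈(l : ℝ) ^ ε⌉ := Int.ceil_nonneg (by positivity)
  obtain ⟨L, hL⟩ := Int.eq_ofNat_of_zero_le hLnn
  rw [hL] at h1 h2
  have hLl : L ≤ l := by
    have : 0 ≤ ⌈x⌉ := Int.ceil_nonneg (by linarith)
    omega
  have hLx : (x + 1) ^ 2 < L := by
    have e1 := Int.le_ceil ((x + 1) ^ 2)
    have e2 : ((⌈(x + 1) ^ 2⌉ : ℤ) : ℝ) < ((L : ℤ) : ℝ) := by exact_mod_cast h1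
    push_cast at e2
    linarith
  have hLe : (l : ℝ) ^ ε ≤ L := by
    have := Int.le_ceil ((l : ℝ) ^ ε)
    rw [hL] at this
    simpa using this
  have hL0 : (0 : ℝ) < L := lt_of_le_of_lt (sq_nonneg _) hLx
  have hlogL : ε * x ≤ Real.log L := by
    rw [hx, ← Real.log_rpow hl0]
    exact Real.log_le_log (by positivity) hLe
  have hex : ∃ a : ℕ, 2 * x ≤ 2 ^ a := by
    obtain ⟨a, ha⟩ := pow_unbounded_of_one_lt (2 * x) (one_lt_two)
    exact ⟨a, ha.le⟩
  classical
  obtain ⟨a, ha, hmin⟩ : ∃ a : ℕ, 2 * x ≤ 2 ^ a ∧ ∀ b < a, ¬ 2 * x ≤ 2 ^ b :=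
    ⟨Nat.find hex, Nat.find_spec hex, fun b hb => Nat.find_min hex hb⟩
  have ha2 : 2 ≤ a := by
    by_contra hcon
    have : a = 0 ∨ a = 1 := by omega
    rcases this with rfl | rfl <;> norm_num at ha <;> linarith
  have hay : (2 : ℝ) ^ a < 4 * x := by
    obtain ⟨b, rfl⟩ : ∃ b, a = b + 1 := ⟨a - 1, by omega⟩
    have := hmin b (by omega)
    rw [pow_succ]
    linarith
  have hlog2 := Real.log_two_lt_d9
  have hlog2' := Real.log_two_gt_d9
  have hlog4 : Real.log 4 = 2 * Real.log 2 := by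
    rw [show (4 : ℝ) = 2 ^ 2 by norm_num, Real.log_pow]; norm_num
  refine ⟨L, a, hL, hLl, ha2, ?_, ?_⟩
  · intro m hm
    rcases Nat.eq_zero_or_pos (m / 2 ^ a) with h0 | h0
    · rw [h0, harmonic_zero, Rat.cast_zero]; positivity
    · have e1 := harmonic_le_one_add_log (m / 2 ^ a)
      have e2 : ((m / 2 ^ a : ℕ) : ℝ) ≤ l / 4 := by
        rw [le_div_iff₀ (by norm_num)]
        have f1 : m / 2 ^ a * 4 ≤ l := by
          calc m / 2 ^ a * 4 ≤ m / 2 ^ a * 2 ^ a :=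
                Nat.mul_le_mul_left _ (by
                  calc 4 = 2 ^ 2 := by norm_num
                    _ ≤ 2 ^ a := Nat.pow_le_pow_right (by norm_num) ha2)
            _ ≤ m := Nat.div_mul_le_self _ _
            _ ≤ l := hm
        exact_mod_cast f1
      have e3 : Real.log ((m / 2 ^ a : ℕ) : ℝ) ≤ Real.log (l / 4) :=
        Real.log_le_log (by exact_mod_cast h0) e2
      rw [Real.log_div hl0.ne' (by norm_num), hlog4] at e3
      linarith
  · set n := L / 2 ^ a with hn
    set Hn : ℝ := ((harmonic n : ℚ) : ℝ) with hHn
    have hyL : 2 ^ a ≤ L := by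
      have : (2 : ℝ) ^ a < L := by nlinarith [sq_nonneg (x - 1)]
      exact_mod_cast this.le
    have hn1 : 1 ≤ n := Nat.div_pos hyL (by positivity)
    have hH1 : 1 ≤ Hn := by
      have : (1 : ℚ) ≤ harmonic n := by
        rw [harmonic]
        have := Finset.single_le_sum (f := fun i : ℕ => ((i + 1 : ℕ) : ℚ)⁻¹) (s := Finset.range n)
          (fun i _ => by positivity) (Finset.mem_range.2 hn1)
        simpa using this
      rw [hHn]
      exact_mod_cast this
    have hH2 := log_add_one_le_harmonic n
    have hypos : (0 : ℝ) < 2 ^ a := by positivity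
    have e1 : (L : ℝ) / 2 ^ a ≤ ((n + 1 : ℕ) : ℝ) := by
      rw [div_le_iff₀ hypos]
      have : L < (n + 1) * 2 ^ a := by
        rw [hn, ← Nat.div_lt_iff_lt_mul (by positivity)]
        exact Nat.lt_succ_self _
      exact_mod_cast this.le
    have e2 := Real.log_le_log (by positivity) e1
    rw [Real.log_div hL0.ne' hypos.ne'] at e2
    have e3 : Real.log (2 ^ a) ≤ Real.log (4 * x) := Real.log_le_log hypos hay.le
    rw [Real.log_mul (by norm_num) (by linarith), hlog4] at e3
    have e4 : 2 * Real.log x ≤ Real.log L := by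
      have : Real.log (x ^ 2) ≤ Real.log L := Real.log_le_log (by positivity) (by nlinarith)
      rw [Real.log_pow] at this
      exact_mod_cast this
    have e5 : ε * x ≤ 4.8 * Hn := by
      push_cast at e2 hH2
      have : Real.log (n + 1) ≤ Hn := hH2
      linarith
    rw [lt_div_iff₀ (by positivity)]
    have : ε * 2 ^ a < ε * (4 * x) := mul_lt_mul_of_pos_left hay hε0
    nlinarith

open scoped Matrix

lemma stdB_eq {F : Type*} [Field F] {l : ℕ} (u v : Fin l ⊕ Fin l → F) :
    stdB F (Fin l) u v = u ⬝ᵥ (Matrix.fromBlocks 0 1 (-1) 0 : Matrix (Fin l ⊕ Fin l) (Fin l ⊕ Fin l) F)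
      *ᵥ v := by
  rw [stdB_apply, Matrix.fromBlocks_mulVec, dotProduct, Fintype.sum_sum_type]
  simp [Matrix.neg_mulVec, sub_eq_add_neg, Finset.sum_add_distrib]

lemma stdB_mul {F : Type*} [Field F] {l : ℕ} (M : Matrix (Fin l ⊕ Fin l) (Fin l ⊕ Fin l) F)
    (u v : Fin l ⊕ Fin l → F) : stdB F (Fin l) (M *ᵥ u) (M *ᵥ v) =
      u ⬝ᵥ (Mᵀ * Matrix.fromBlocks 0 1 (-1) 0 * M) *ᵥ v := by
  rw [stdB_eq, ← Matrix.mulVec_mulVec, ← Matrix.mulVec_mulVec, Matrix.dotProduct_mulVec u,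
    Matrix.vecMul_transpose]

lemma mat_ext {F n : Type*} [Field F] [Fintype n] [DecidableEq n] (A A' : Matrix n n F)
    (h : ∀ u v, u ⬝ᵥ A *ᵥ v = u ⬝ᵥ A' *ᵥ v) : A = A' := by
  ext i j
  have := h (Pi.single i 1) (Pi.single j 1)
  simpa using this

end S16

theorem stmt16 (ε : ℝ) (hε : ε ∈ Set.Ioo (0 : ℝ) 1) (ℓ : ℕ)
    (h1 : ⌈(Real.log ℓ + 1) ^ 2⌉ < ⌈(ℓ : ℝ) ^ ε⌉)
    (h2 : ⌈(ℓ : ℝ) ^ ε⌉ ≤ (ℓ : ℤ) - 2 * ⌈Real.log ℓ⌉)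
    (F : Type*) [Field F] [Fintype F] (hF : Odd (Fintype.card F))
    (J : Matrix (Fin ℓ ⊕ Fin ℓ) (Fin ℓ ⊕ Fin ℓ) F)
    (hJ : J = Matrix.fromBlocks 0 1 (-1) 0)
    (H : Subgroup (GL (Fin ℓ ⊕ Fin ℓ) F))
    (hSp : ∀ M : GL (Fin ℓ ⊕ Fin ℓ) F,
      (M : Matrix (Fin ℓ ⊕ Fin ℓ) (Fin ℓ ⊕ Fin ℓ) F)ᵀ * J *
        (M : Matrix (Fin ℓ ⊕ Fin ℓ) (Fin ℓ ⊕ Fin ℓ) F) = J → M ∈ H)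
    (hGSp : ∀ M ∈ H, ∃ lam : F, lam ≠ 0 ∧
      (M : Matrix (Fin ℓ ⊕ Fin ℓ) (Fin ℓ ⊕ Fin ℓ) F)ᵀ * J *
        (M : Matrix (Fin ℓ ⊕ Fin ℓ) (Fin ℓ ⊕ Fin ℓ) F) = lam • J) :
    (Nat.card {h : H // Even (orderOf h) ∧ orderOf (h ^ (orderOf h / 2)) = 2 ∧
        ((negOneEigDim F (((h ^ (orderOf h / 2) : H) : GL (Fin ℓ ⊕ Fin ℓ) F) :
            Matrix (Fin ℓ ⊕ Fin ℓ) (Fin ℓ ⊕ Fin ℓ) F) : ℤ) ≤ 2 * ⌈(ℓ : ℝ) ^ ε⌉)} : ℝ) /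
      Nat.card H > ε / 768 := by
  classical
  subst hJ
  obtain ⟨L, a, hL, hLl, ha2, hharm, hfin⟩ := S16.analytic ε hε ℓ h1 h2
  have hq1 : 1 < Nat.card F := Finite.one_lt_card
  have hqo : Odd (Nat.card F) := by rwa [Nat.card_eq_fintype_card]
  obtain ⟨s, hs⟩ := S16.exists_thr (Nat.card F) a hqo hq1 ha2
  have h2F : (2 : F) ≠ 0 := by
    intro h0
    have hc : ringChar F = 2 :=
      ((Nat.dvd_prime Nat.prime_two).1 (ringChar.dvd (R := F) (x := 2) (by exact_mod_cast h0))).resolve_left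
        CharP.ringChar_ne_one
    have := FiniteField.even_card_iff_char_two.1 hc
    rw [Nat.odd_iff] at hF
    omega
  let ψ : GL (Fin ℓ ⊕ Fin ℓ) F ≃* ((Fin ℓ ⊕ Fin ℓ → F) ≃ₗ[F] (Fin ℓ ⊕ Fin ℓ → F)) :=
    Matrix.GeneralLinearGroup.toLin.trans (LinearMap.GeneralLinearGroup.generalLinearEquiv F _)
  have hψ : ∀ M v, ψ M v = (M : Matrix (Fin ℓ ⊕ Fin ℓ) (Fin ℓ ⊕ Fin ℓ) F) *ᵥ v := fun M v => rfl
  obtain ⟨Λ, hΛ⟩ := S16.exists_simil (S16.stdB F (Fin ℓ)) (H.map ψ.toMonoidHom)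
    (by
      rintro g ⟨c, hc, hg⟩
      rw [Subgroup.mem_bot] at hc
      subst hc
      obtain ⟨M, rfl⟩ := ψ.surjective g
      refine ⟨M, hSp M (S16.mat_ext _ _ fun u v => ?_), rfl⟩
      rw [← S16.stdB_mul, ← hψ, ← hψ, hg, Units.val_one, one_mul, S16.stdB_eq])
    (by
      rintro _ ⟨M, hM, rfl⟩
      obtain ⟨c, hc0, hc⟩ := hGSp M hM
      refine ⟨Units.mk0 c hc0, Subgroup.mem_top _, fun u v => ?_⟩
      change S16.stdB F (Fin ℓ) (ψ M u) (ψ M v) = c * _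
      rw [hψ, hψ, S16.stdB_mul, hc, Matrix.smul_mulVec, dotProduct_smul, smul_eq_mul, S16.stdB_eq])
  have hcard := S16.good_sum (S16.simil (S16.stdB F (Fin ℓ)) Λ) (2 ^ a) (by positivity) (L / 2 ^ a)
    (by
      intro i hi
      refine S16.good_std h2F Λ hs (by positivity) (dvd_mul_right _ _) ?_ (hharm _ (Nat.sub_le _ _))
      have : (i + 1) * 2 ^ a ≤ L := (Nat.le_div_iff_mul_le (by positivity)).1 hi
      rw [mul_comm] at this
      exact this.trans hLl)
  rw [← hΛ] at hcard
  let E : H ≃* H.map ψ.toMonoidHom := ψ.subgroupMap H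
  have hE : ∀ h, (E h).1 = ψ h.1 := fun h => rfl
  have hGH : Nat.card (H.map ψ.toMonoidHom) = Nat.card H := (Nat.card_congr E.toEquiv).symm
  have hle : Nat.card {g : H.map ψ.toMonoidHom // ∃ i < L / 2 ^ a, S16.good (2 ^ a * (i + 1)) g.1} ≤
      Nat.card {h : H // Even (orderOf h) ∧ orderOf (h ^ (orderOf h / 2)) = 2 ∧
        ((negOneEigDim F (((h ^ (orderOf h / 2) : H) : GL (Fin ℓ ⊕ Fin ℓ) F) :
            Matrix (Fin ℓ ⊕ Fin ℓ) (Fin ℓ ⊕ Fin ℓ) F) : ℤ) ≤ 2 * ⌈(ℓ : ℝ) ^ ε⌉)} := by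
    refine Nat.card_le_card_of_injective (fun g => ⟨E.symm g.1, ?_⟩) ?_
    · obtain ⟨g, i, hi, hgood⟩ := g
      obtain ⟨h, rfl⟩ := E.surjective g
      simp only [MulEquiv.symm_apply_apply]
      obtain ⟨g1, g2⟩ := hgood
      have ho : orderOf (E h).1 = orderOf h := by
        rw [Subgroup.orderOf_coe, MulEquiv.orderOf_eq]
      rw [ho] at g1 g2
      have hpos : 0 < orderOf h := orderOf_pos h
      refine ⟨g1, ?_, ?_⟩
      · rw [orderOf_pow_of_dvd (by obtain ⟨t, ht⟩ := g1; omega) (Nat.div_dvd_of_dvd g1.two_dvd)]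
        exact Nat.div_div_self g1.two_dvd hpos.ne'
      · have hk : negOneEigDim F (((h ^ (orderOf h / 2) : H) : GL (Fin ℓ ⊕ Fin ℓ) F) :
            Matrix (Fin ℓ ⊕ Fin ℓ) (Fin ℓ ⊕ Fin ℓ) F) = 2 * (2 ^ a * (i + 1)) := by
          rw [← g2, negOneEigDim, map_add, Matrix.toLin'_one, hE, ← map_pow, Subgroup.coe_pow]
          rfl
        rw [hk, hL]
        have : (i + 1) * 2 ^ a ≤ L := (Nat.le_div_iff_mul_le (by positivity)).1 hi
        rw [mul_comm] at this
        exact_mod_cast Nat.mul_le_mul_left 2 this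
    · intro g g' hgg
      exact Subtype.ext (E.symm.injective (congrArg Subtype.val hgg))
  have hHpos : (0 : ℝ) < Nat.card H := by exact_mod_cast Nat.card_pos
  rw [gt_iff_lt, lt_div_iff₀ hHpos]
  rw [hGH] at hcard
  push_cast at hcard
  calc ε / 768 * Nat.card H < ((harmonic (L / 2 ^ a) : ℚ) : ℝ) / (16 * 2 ^ a) * Nat.card H :=
        mul_lt_mul_of_pos_right hfin hHpos
    _ = _ := mul_comm _ _
    _ ≤ _ := hcard
    _ ≤ _ := by exact_mod_cast hle
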